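/- Let B be the open unit ball in ℝ^n (n ≥ 2) and B₀ the open ball of radius ρ_n = 2^{−1/n} centered at 0. Suppose ω is real-valued, continuous on the closed unit ball and subharmonic on B, and h is real-valued, continuous on the closed unit ball and harmonic on B. Then h is a best approximant to ω in L^1(B) among integrable harmonic functions (i.e. ∫_B |ω − h| dx ≤ ∫_B |ω − u| dx for all u ∈ L^1_h(B)) if and only if (i) h = ω on the sphere ∂B₀, and (ii) h ≤ ω on the closed unit ball minus B₀. -/

import Mathlib

open MeasureTheory Metric
open scoped ENNReal

/-- The Laplacian of `f : ℝⁿ → ℝ`, computed via second derivatives in the coordinate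
directions. -/
noncomputable def lap {n : ℕ} (f : EuclideanSpace ℝ (Fin n) → ℝ)
    (x : EuclideanSpace ℝ (Fin n)) : ℝ :=
  ∑ j : Fin n, fderiv ℝ (fun y => fderiv ℝ f y (EuclideanSpace.single j 1)) x
    (EuclideanSpace.single j 1)

/-- `f` is harmonic on `U`: twice continuously differentiable with vanishing Laplacian. -/
def HarmonicOn {n : ℕ} (f : EuclideanSpace ℝ (Fin n) → ℝ)
    (U : Set (EuclideanSpace ℝ (Fin n))) : Prop :=
  ContDiffOn ℝ 2 f U ∧ ∀ x ∈ U, lap f x = 0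

/-- `f` is subharmonic on `U`: upper semicontinuous and satisfying the sub-mean value
inequality on closed balls contained in `U`. -/
def SubharmonicOn {n : ℕ} (f : EuclideanSpace ℝ (Fin n) → ℝ)
    (U : Set (EuclideanSpace ℝ (Fin n))) : Prop :=
  UpperSemicontinuousOn f U ∧ ∀ x ∈ U, ∀ r : ℝ, 0 < r → closedBall x r ⊆ U →
    f x ≤ ⨍ y in closedBall x r, f y

/-- `ρ_n = 2^{-1/n}`. -/
noncomputable def rhon (n : ℕ) : ℝ := (2 : ℝ) ^ (-(1 : ℝ) / n)

section helpers

open Set Filter Topology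

lemma lap_congr {n : ℕ} {f g : EuclideanSpace ℝ (Fin n) → ℝ} {x : EuclideanSpace ℝ (Fin n)}
    (h : f =ᶠ[𝓝 x] g) : lap f x = lap g x := by
  unfold lap
  refine Finset.sum_congr rfl fun j _ => ?_
  have h1 : (fun y => fderiv ℝ f y (EuclideanSpace.single j 1)) =ᶠ[𝓝 x]
      (fun y => fderiv ℝ g y (EuclideanSpace.single j 1)) := by
    filter_upwards [h.fderiv (𝕜 := ℝ)] with y hy
    rw [hy]
  rw [h1.fderiv_eq]

lemma lap_lin {n : ℕ} {f g : EuclideanSpace ℝ (Fin n) → ℝ} {x : EuclideanSpace ℝ (Fin n)} (a : ℝ)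
    (hf : ContDiffAt ℝ 2 f x) (hg : ContDiffAt ℝ 2 g x) :
    lap (fun y => f y + a * g y) x = lap f x + a * lap g x := by
  unfold lap
  rw [Finset.mul_sum, ← Finset.sum_add_distrib]
  refine Finset.sum_congr rfl fun j _ => ?_
  have h1 : (fun y => fderiv ℝ (fun y => f y + a * g y) y (EuclideanSpace.single j 1)) =ᶠ[𝓝 x]
      (fun y => fderiv ℝ f y (EuclideanSpace.single j 1)
        + a * fderiv ℝ g y (EuclideanSpace.single j 1)) := by
    filter_upwards [hf.eventually (by simp), hg.eventually (by simp)] with y h1 h2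
    have d1 := h1.differentiableAt (by simp)
    have d2 := h2.differentiableAt (by simp)
    rw [fderiv_fun_add d1 (d2.const_mul a), fderiv_const_mul d2]
    simp
  rw [h1.fderiv_eq]
  have e1 : DifferentiableAt ℝ (fun y => fderiv ℝ f y (EuclideanSpace.single j 1)) x :=
    ((hf.fderiv_right (m := 1) (by norm_num)).differentiableAt (by simp)).clm_apply (by fun_prop)
  have e2 : DifferentiableAt ℝ (fun y => fderiv ℝ g y (EuclideanSpace.single j 1)) x :=
    ((hg.fderiv_right (m := 1) (by norm_num)).differentiableAt (by simp)).clm_apply (by fun_prop)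
  rw [fderiv_fun_add e1 (e2.const_mul a), fderiv_const_mul e2]
  simp

lemma HarmonicOn.lin {n : ℕ} {f g : EuclideanSpace ℝ (Fin n) → ℝ}
    {U : Set (EuclideanSpace ℝ (Fin n))} (hU : IsOpen U) (a : ℝ)
    (hf : HarmonicOn f U) (hg : HarmonicOn g U) :
    HarmonicOn (fun y => f y + a * g y) U := by
  refine ⟨hf.1.add (contDiffOn_const.mul hg.1), fun x hx => ?_⟩
  rw [lap_lin a (hf.1.contDiffAt (hU.mem_nhds hx)) (hg.1.contDiffAt (hU.mem_nhds hx)),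
    hf.2 x hx, hg.2 x hx]
  simp

lemma HarmonicOn.const {n : ℕ} (c : ℝ) (U : Set (EuclideanSpace ℝ (Fin n))) :
    HarmonicOn (fun _ => c) U := by
  refine ⟨contDiffOn_const, fun x _ => ?_⟩
  simp [lap]

/-- spherical weight mean value for a global `C²` compactly supported function -/
lemma mvp_global {n : ℕ} {v : EuclideanSpace ℝ (Fin n) → ℝ} (c : EuclideanSpace ℝ (Fin n))
    (hv : ContDiff ℝ 2 v) (hvc : HasCompactSupport v) (s0 : ℝ) (hs0 : 0 < s0)
    (hl : ∀ x, ‖x - c‖ ^ 2 < s0 → lap v x = 0)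
    (g : ℝ → ℝ) (hg : Continuous g) (hg0 : ∀ s, s0 ≤ s → g s = 0) :
    ∫ x, g (‖x‖ ^ 2) * v (c + x) = v c * ∫ x : EuclideanSpace ℝ (Fin n), g (‖x‖ ^ 2) := by
  classical
  -- the primitive
  set η : ℝ → ℝ := fun s => ∫ t in s0..s, g t with hη
  have hηd : ∀ s, HasDerivAt η (g s) s := fun s =>
    intervalIntegral.integral_hasDerivAt_right (hg.intervalIntegrable _ _)
      hg.aestronglyMeasurable.stronglyMeasurableAtFilter hg.continuousAt
  have hη0 : ∀ s, s0 ≤ s → η s = 0 := by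
    intro s hs
    rw [hη]
    simp only
    rw [intervalIntegral.integral_congr (g := fun _ => (0:ℝ))]
    · simp
    · intro t ht
      rw [uIcc_of_le hs] at ht
      exact hg0 t ht.1
  set H : EuclideanSpace ℝ (Fin n) → ℝ := fun x => η (‖x‖ ^ 2) with hH
  have hHd : ∀ x, HasFDerivAt H (g (‖x‖^2) • (2 • (innerSL ℝ x))) x := by
    intro x
    exact (hηd (‖x‖^2)).comp_hasFDerivAt x (hasStrictFDerivAt_norm_sq x).hasFDerivAt
  have hsupp : ∀ φ : EuclideanSpace ℝ (Fin n) → ℝ, (∀ x, s0 ≤ ‖x‖^2 → φ x = 0) →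
      HasCompactSupport φ := by
    intro φ hφ
    refine HasCompactSupport.intro (isCompact_closedBall (0 : EuclideanSpace ℝ (Fin n)) (Real.sqrt s0)) ?_
    intro x hx
    apply hφ
    simp only [mem_closedBall, dist_zero_right, not_le] at hx
    exact (Real.lt_sq_of_sqrt_lt hx).le
  have hηc : Continuous η := continuous_iff_continuousAt.2 fun s => (hηd s).continuousAt
  have hHc : Continuous H := by fun_prop
  have hgc : Continuous (fun x : EuclideanSpace ℝ (Fin n) => g (‖x‖^2)) := by fun_prop
  have hgs : HasCompactSupport (fun x : EuclideanSpace ℝ (Fin n) => g (‖x‖^2)) :=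
    hsupp _ (fun x hx => hg0 _ hx)
  have hdv : Continuous (fderiv ℝ v) := hv.continuous_fderiv (by simp)
  have hv1 : ContDiff ℝ 1 (fderiv ℝ v) := hv.fderiv_right (by norm_num)
  obtain ⟨C, hC⟩ : ∃ C, ∀ x, ‖fderiv ℝ v x‖ ≤ C :=
    (hvc.fderiv ℝ).exists_bound_of_continuous hdv
  set A : ℝ → ℝ := fun r => ∫ x, g (‖x‖ ^ 2) * v (c + r • x) with hA
  have key : ∀ r ∈ Icc (0:ℝ) 1, HasDerivAt A 0 r := by
    intro r hr
    have h1 : HasDerivAt A (∫ x, g (‖x‖^2) * fderiv ℝ v (c + r • x) x) r := by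
      refine (hasDerivAt_integral_of_dominated_loc_of_deriv_le (𝕜 := ℝ) (μ := volume)
        (F := fun r x => g (‖x‖ ^ 2) * v (c + r • x))
        (F' := fun r x => g (‖x‖^2) * fderiv ℝ v (c + r • x) x)
        (bound := fun x : EuclideanSpace ℝ (Fin n) => |g (‖x‖^2)| * (C * ‖x‖)) (s := univ) univ_mem ?_ ?_ ?_ ?_ ?_ ?_).2
      · refine Eventually.of_forall fun r => Continuous.aestronglyMeasurable ?_
        have := hv.continuous
        fun_prop
      · refine Continuous.integrable_of_hasCompactSupport ?_ (hgs.mul_right)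
        have := hv.continuous
        fun_prop
      · refine Continuous.aestronglyMeasurable ?_
        fun_prop
      · refine Eventually.of_forall fun x r _ => ?_
        rw [norm_mul]
        refine mul_le_mul_of_nonneg_left ?_ (norm_nonneg _)
        exact (ContinuousLinearMap.le_opNorm _ _).trans
          (mul_le_mul_of_nonneg_right (hC _) (norm_nonneg _))
      · refine Continuous.integrable_of_hasCompactSupport (by fun_prop) ?_
        exact hsupp _ (fun x hx => by simp [hg0 _ hx])
      · refine Eventually.of_forall fun x r _ => ?_
        have hd : HasDerivAt (fun r : ℝ => c + r • x) x r := by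
          simpa using ((hasDerivAt_id r).smul_const x).const_add c
        exact (((hv.differentiable (by simp)) (c + r • x)).hasFDerivAt.comp_hasDerivAt r hd).const_mul _
    convert h1 using 1
    symm
    have h2 : ∀ x, g (‖x‖^2) * fderiv ℝ v (c + r • x) x
        = ∑ j : Fin n, (1/2) * (fderiv ℝ H x (EuclideanSpace.single j 1) *
            fderiv ℝ v (c + r • x) (EuclideanSpace.single j 1)) := by
      intro x
      have hx : x = ∑ j : Fin n, x j • EuclideanSpace.single j (1:ℝ) := by
        have := (EuclideanSpace.basisFun (Fin n) ℝ).sum_repr x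
        simpa using this.symm
      conv_lhs => rw [show fderiv ℝ v (c + r • x) x = fderiv ℝ v (c + r • x)
        (∑ j : Fin n, x j • EuclideanSpace.single j (1:ℝ)) by rw [← hx]]
      rw [map_sum, Finset.mul_sum]
      refine Finset.sum_congr rfl fun j _ => ?_
      rw [(hHd x).fderiv]
      simp [EuclideanSpace.inner_single_right]
      ring
    have hpart : ∀ j : Fin n, ∫ x, fderiv ℝ H x (EuclideanSpace.single j 1) *
            fderiv ℝ v (c + r • x) (EuclideanSpace.single j 1)
        = - ∫ x, H x * (r * fderiv ℝ (fun y => fderiv ℝ v y (EuclideanSpace.single j 1)) (c + r • x)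
            (EuclideanSpace.single j 1)) := by
      intro j
      have hvj : ContDiff ℝ 1 (fun y => fderiv ℝ v y (EuclideanSpace.single j 1)) :=
        hv1.clm_apply contDiff_const
      have hd : ∀ x, HasFDerivAt (fun x => fderiv ℝ v (c + r • x) (EuclideanSpace.single j 1))
          ((fderiv ℝ (fun y => fderiv ℝ v y (EuclideanSpace.single j 1)) (c + r • x)).comp
            (r • ContinuousLinearMap.id ℝ _)) x := by
        intro x
        have hin : HasFDerivAt (fun x : EuclideanSpace ℝ (Fin n) => c + r • x)
            (r • ContinuousLinearMap.id ℝ _) x :=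
          ((hasFDerivAt_id x).const_smul r).const_add c
        exact ((hvj.differentiable (by simp)) (c + r • x)).hasFDerivAt.comp x hin
      have hcont : Continuous fun x => fderiv ℝ (fun y => fderiv ℝ v y (EuclideanSpace.single j 1)) (c + r • x)
            (EuclideanSpace.single j 1) := by
        have := hvj.continuous_fderiv (by simp)
        fun_prop
      have hHs : HasCompactSupport H := hsupp _ (fun x hx => hη0 _ hx)
      have h3 := integral_mul_fderiv_eq_neg_fderiv_mul_of_integrable (μ := volume)
        (f := H) (g := fun x => fderiv ℝ v (c + r • x) (EuclideanSpace.single j 1))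
        (v := EuclideanSpace.single j 1) ?_ ?_ ?_ ?_ ?_
      · have h4 : ∀ x, fderiv ℝ (fun x => fderiv ℝ v (c + r • x) (EuclideanSpace.single j 1)) x
            (EuclideanSpace.single j 1) = r * fderiv ℝ (fun y => fderiv ℝ v y (EuclideanSpace.single j 1)) (c + r • x)
            (EuclideanSpace.single j 1) := by
          intro x; rw [(hd x).fderiv]; simp
        simp only [h4] at h3
        linarith
      · refine Continuous.integrable_of_hasCompactSupport ?_ ?_
        · refine Continuous.mul ?_ (by fun_prop)
          simp only [fun x => (hHd x).fderiv]
          fun_prop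
        · refine hsupp _ fun x hx => ?_
          rw [(hHd x).fderiv, hg0 _ hx]; simp
      · simp only [fun x => (hd x).fderiv]
        refine Continuous.integrable_of_hasCompactSupport ?_ hHs.mul_right
        refine hHc.mul ?_
        simpa using hcont.const_mul r
      · exact Continuous.integrable_of_hasCompactSupport (by fun_prop) hHs.mul_right
      · exact fun x _ => (hHd x).differentiableAt
      · exact fun x _ => (hd x).differentiableAt
    simp only [h2]
    have hint : ∀ j : Fin n, Integrable fun x => fderiv ℝ H x (EuclideanSpace.single j 1) *
            fderiv ℝ v (c + r • x) (EuclideanSpace.single j 1) := by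
      intro j
      refine Continuous.integrable_of_hasCompactSupport ?_ ?_
      · refine Continuous.mul ?_ (by fun_prop)
        simp only [fun x => (hHd x).fderiv]
        fun_prop
      · refine hsupp _ fun x hx => ?_
        rw [(hHd x).fderiv, hg0 _ hx]; simp
    have hint2 : ∀ j : Fin n, Integrable fun x => H x * (r * fderiv ℝ (fun y => fderiv ℝ v y (EuclideanSpace.single j 1)) (c + r • x)
            (EuclideanSpace.single j 1)) := by
      intro j
      have hvj : ContDiff ℝ 1 (fun y => fderiv ℝ v y (EuclideanSpace.single j 1)) :=
        hv1.clm_apply contDiff_const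
      have hcont : Continuous fun x => fderiv ℝ (fun y => fderiv ℝ v y (EuclideanSpace.single j 1)) (c + r • x)
            (EuclideanSpace.single j 1) := by
        have := hvj.continuous_fderiv (by simp)
        fun_prop
      have hHs : HasCompactSupport H := hsupp _ (fun x hx => hη0 _ hx)
      exact Continuous.integrable_of_hasCompactSupport (hHc.mul (continuous_const.mul hcont)) hHs.mul_right
    rw [integral_finsetSum _ (fun j _ => (hint j).const_mul _)]
    simp only [integral_const_mul, hpart]
    rw [← Finset.mul_sum, Finset.sum_neg_distrib, ← integral_finsetSum _ (fun j _ => hint2 j)]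
    have h0 : ∀ x, ∑ j : Fin n, H x * (r * fderiv ℝ (fun y => fderiv ℝ v y (EuclideanSpace.single j 1)) (c + r • x)
            (EuclideanSpace.single j 1)) = 0 := by
      intro x
      rw [← Finset.mul_sum, ← Finset.mul_sum]
      by_cases hx : s0 ≤ ‖x‖^2
      · have : H x = 0 := hη0 _ hx
        simp [this]
      · have := hl (c + r • x) (by
          simp only [add_sub_cancel_left, norm_smul, mul_pow]
          have h5 : ‖r‖^2 ≤ 1 := by
            rw [Real.norm_of_nonneg hr.1]; exact pow_le_one₀ hr.1 hr.2
          nlinarith [sq_nonneg ‖x‖])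
        unfold lap at this
        rw [this]; simp
    simp only [h0]; simp
  have hconst : A 1 = A 0 := by
    apply constant_of_has_deriv_right_zero (a := 0) (b := 1) (f := A)
    · exact fun r hr => (key r hr).continuousAt.continuousWithinAt
    · exact fun r hr => (key r ⟨hr.1, hr.2.le⟩).hasDerivWithinAt
    · simp
  simp only [hA, one_smul, zero_smul, add_zero] at hconst
  rw [hconst, integral_mul_const, mul_comm]


lemma mvp {n : ℕ} {u : EuclideanSpace ℝ (Fin n) → ℝ} (c : EuclideanSpace ℝ (Fin n)) (R : ℝ)
    (hR : 0 < R) (hu : HarmonicOn u (ball c R)) (hi : IntegrableOn u (ball c R)) :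
    ∫ x in ball c R, u x = volume.real (ball c R) * u c := by
  -- weighted version
  have hw : ∀ (s0 : ℝ) (g : ℝ → ℝ), 0 < s0 → s0 < R^2 → Continuous g → (∀ s, s0 ≤ s → g s = 0) →
      ∫ x in ball (0 : EuclideanSpace ℝ (Fin n)) R, g (‖x‖^2) * u (c + x)
        = u c * ∫ x in ball (0 : EuclideanSpace ℝ (Fin n)) R, g (‖x‖^2) := by
    intro s0 g h0 h1 hg hg0
    set R1 := Real.sqrt s0 with hR1
    have hR1p : 0 < R1 := Real.sqrt_pos.2 h0
    have hR1R : R1 < R := (Real.sqrt_lt' hR).2 h1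
    let χ : ContDiffBump c := ⟨R1, (R1 + R)/2, hR1p, by linarith⟩
    set v : EuclideanSpace ℝ (Fin n) → ℝ := fun x => χ x * u x with hvdef
    have hts : tsupport χ ⊆ ball c R := by
      rw [χ.tsupport_eq]
      exact closedBall_subset_ball (by show (R1 + R)/2 < R; linarith)
    have hv : ContDiff ℝ 2 v := by
      rw [contDiff_iff_contDiffAt]
      intro x
      by_cases hx : x ∈ ball c R
      · exact χ.contDiff.contDiffAt.mul (hu.1.contDiffAt (isOpen_ball.mem_nhds hx))
      · have : v =ᶠ[𝓝 x] fun _ => 0 := by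
          have h2 : x ∉ tsupport χ := fun h => hx (hts h)
          filter_upwards [(isClosed_tsupport χ).isOpen_compl.mem_nhds h2] with y hy
          simp [hvdef, image_eq_zero_of_notMem_tsupport hy]
        exact contDiffAt_const.congr_of_eventuallyEq this
    have hvc : HasCompactSupport v := χ.hasCompactSupport.mul_right
    have hveq : ∀ x ∈ closedBall c R1, v x = u x := by
      intro x hx
      simp [hvdef, χ.one_of_mem_closedBall hx]
    have hin : ∀ x : EuclideanSpace ℝ (Fin n), ‖x‖^2 < s0 → ‖x‖ < R1 := by
      intro x hx
      exact Real.lt_sqrt_of_sq_lt hx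
    have hl : ∀ x, ‖x - c‖ ^ 2 < s0 → lap v x = 0 := by
      intro x hx
      have h3 : x ∈ ball c R1 := by rw [mem_ball_iff_norm]; exact hin _ hx
      rw [lap_congr (g := u)]
      · exact hu.2 x (ball_subset_ball hR1R.le h3)
      · filter_upwards [isOpen_ball.mem_nhds h3] with y hy
        exact hveq y (ball_subset_closedBall hy)
    have hmain := mvp_global c hv hvc s0 h0 hl g hg hg0
    rw [hveq c (mem_closedBall_self hR1p.le)] at hmain
    have hout : ∀ x : EuclideanSpace ℝ (Fin n), x ∉ ball (0 : EuclideanSpace ℝ (Fin n)) R → g (‖x‖^2) = 0 := by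
      intro x hx
      simp only [mem_ball, dist_zero_right, not_lt] at hx
      apply hg0
      nlinarith
    rw [setIntegral_eq_integral_of_forall_compl_eq_zero hout,
      setIntegral_eq_integral_of_forall_compl_eq_zero (fun x hx => by rw [hout x hx, zero_mul]), ← hmain]
    congr 1
    ext x
    by_cases hx : s0 ≤ ‖x‖^2
    · simp [hg0 _ hx]
    · rw [hveq]
      simp only [mem_closedBall, dist_self_add_left]
      exact (hin x (not_le.1 hx)).le
  set gk : ℕ → ℝ → ℝ := fun k s => min 1 (max 0 ((k+2) * (R^2 - R^2/(k+2) - s))) with hgk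
  have hgc : ∀ k, Continuous (gk k) := fun k => by fun_prop
  have hR2 : 0 < R^2 := by positivity
  have hk : ∀ k, ∫ x in ball (0 : EuclideanSpace ℝ (Fin n)) R, gk k (‖x‖^2) * u (c + x)
        = u c * ∫ x in ball (0 : EuclideanSpace ℝ (Fin n)) R, gk k (‖x‖^2) := by
    intro k
    have hk2 : (1:ℝ) < k + 2 := by
      have : (0:ℝ) ≤ k := Nat.cast_nonneg k
      linarith
    refine hw (R^2 - R^2/(k+2)) _ ?_ ?_ (hgc k) ?_
    · have : R^2/(k+2) < R^2 := div_lt_self hR2 hk2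
      linarith
    · have : 0 < R^2/((k:ℝ)+2) := by positivity
      linarith
    · intro s hs
      simp only [hgk]
      have : ((k:ℝ)+2) * (R^2 - R^2/(k+2) - s) ≤ 0 := by
        apply mul_nonpos_of_nonneg_of_nonpos <;> linarith
      rw [max_eq_left this]; simp
  have hg1 : ∀ k s, ‖gk k s‖ ≤ 1 := by
    intro k s
    rw [Real.norm_of_nonneg (le_min zero_le_one (le_max_left _ _))]
    exact min_le_left _ _
  have hgl : ∀ s, s < R^2 → Tendsto (fun k => gk k s) atTop (𝓝 1) := by
    intro s hs
    have : ∀ᶠ k : ℕ in atTop, gk k s = 1 := by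
      obtain ⟨K, hK⟩ := exists_nat_gt ((1 + R^2) / (R^2 - s))
      filter_upwards [eventually_ge_atTop K] with k hkK
      simp only [hgk]
      have h1 : (1 + R^2) < k * (R^2 - s) := by
        have h2 : (K:ℝ) ≤ k := by exact_mod_cast hkK
        rw [div_lt_iff₀ (by linarith)] at hK
        nlinarith
      have h3 : ((k:ℝ)+2) * (R^2 - R^2/(k+2) - s) = (k+2) * (R^2 - s) - R^2 := by
        field_simp
        ring
      rw [h3]
      apply min_eq_left
      apply le_max_of_le_right
      nlinarith
    exact tendsto_const_nhds.congr' (this.mono fun k hk => hk.symm)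
  have himg : (fun x => c + x) ⁻¹' (ball c R) = ball (0 : EuclideanSpace ℝ (Fin n)) R := by
    ext x; simp
  have hmp := measurePreserving_add_left (volume : Measure (EuclideanSpace ℝ (Fin n))) c
  have hme : MeasurableEmbedding (fun x : EuclideanSpace ℝ (Fin n) => c + x) := measurableEmbedding_addLeft c
  have hi' : IntegrableOn (fun x => u (c + x)) (ball (0 : EuclideanSpace ℝ (Fin n)) R) := by
    have := (hmp.integrableOn_comp_preimage hme (f := u) (s := ball c R)).2 hi
    rwa [himg] at this
  have hie : ∫ x in ball c R, u x = ∫ x in ball (0 : EuclideanSpace ℝ (Fin n)) R, u (c + x) := by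
    rw [← hmp.setIntegral_preimage_emb hme, himg]
  have L1 : Tendsto (fun k => ∫ x in ball (0 : EuclideanSpace ℝ (Fin n)) R, gk k (‖x‖^2) * u (c + x)) atTop
      (𝓝 (∫ x in ball (0 : EuclideanSpace ℝ (Fin n)) R, u (c + x))) := by
    refine tendsto_integral_of_dominated_convergence (fun x => ‖u (c + x)‖) ?_ hi'.norm ?_ ?_
    · intro k
      exact (Continuous.aestronglyMeasurable (by have := hgc k; fun_prop)).mul hi'.1
    · intro k
      refine Eventually.of_forall fun x => ?_
      rw [norm_mul]
      exact mul_le_of_le_one_left (norm_nonneg _) (hg1 _ _)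
    · filter_upwards [ae_restrict_mem measurableSet_ball] with x hx
      have : ‖x‖^2 < R^2 := by
        rw [mem_ball_zero_iff] at hx
        exact pow_lt_pow_left₀ hx (norm_nonneg _) (by simp)
      simpa using (hgl _ this).mul_const (u (c + x))
  have L2 : Tendsto (fun k => u c * ∫ x in ball (0 : EuclideanSpace ℝ (Fin n)) R, gk k (‖x‖^2)) atTop
      (𝓝 (u c * ∫ x in ball (0 : EuclideanSpace ℝ (Fin n)) R, (1:ℝ))) := by
    refine Tendsto.const_mul _ ?_
    refine tendsto_integral_of_dominated_convergence (fun x => 1) ?_ ?_ ?_ ?_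
    · intro k
      exact (Continuous.aestronglyMeasurable (by have := hgc k; fun_prop))
    · exact integrableOn_const (measure_ball_lt_top.ne)
    · intro k
      refine Eventually.of_forall fun x => hg1 _ _
    · filter_upwards [ae_restrict_mem measurableSet_ball] with x hx
      have : ‖x‖^2 < R^2 := by
        rw [mem_ball_zero_iff] at hx
        exact pow_lt_pow_left₀ hx (norm_nonneg _) (by simp)
      exact (hgl _ this)
  have hvol : volume.real (ball c R) = volume.real (ball (0 : EuclideanSpace ℝ (Fin n)) R) := by
    simp only [Measure.real]
    rw [Measure.addHaar_ball_center]
  have := tendsto_nhds_unique L1 (by simpa only [hk] using L2)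
  rw [hie, this, hvol]
  simp [mul_comm]

/-- basic harmonic kernel -/
noncomputable def hker {n : ℕ} (α : ℝ) (b z : EuclideanSpace ℝ (Fin n)) : ℝ :=
  (α * ‖z‖ ^ 2 + inner ℝ b z) * (‖z‖ ^ n)⁻¹

lemma hker_contDiffAt {n : ℕ} (α : ℝ) (b z : EuclideanSpace ℝ (Fin n)) (hz : z ≠ 0) :
    ContDiffAt ℝ 2 (hker α b) z := by
  unfold hker
  have h1 : ContDiffAt ℝ 2 (fun z : EuclideanSpace ℝ (Fin n) => ‖z‖) z := contDiffAt_norm ℝ hz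
  have h2 : ContDiffAt ℝ 2 (fun z : EuclideanSpace ℝ (Fin n) => inner ℝ b z) z :=
    contDiffAt_const.inner ℝ contDiffAt_id
  exact ((contDiffAt_const.mul (h1.pow 2)).add h2).mul ((h1.pow n).inv (pow_ne_zero n (norm_ne_zero_iff.2 hz)))

lemma norm_pow_inv_eq {n : ℕ} (z : EuclideanSpace ℝ (Fin n)) :
    (‖z‖ ^ n)⁻¹ = (‖z‖ ^ 2) ^ (-(n:ℝ)/2) := by
  rw [← Real.rpow_natCast ‖z‖ 2, ← Real.rpow_mul (norm_nonneg _), ← Real.rpow_natCast,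
    ← Real.rpow_neg (norm_nonneg _)]
  congr 1; push_cast; ring

lemma hker_lap {n : ℕ} (α : ℝ) (b z : EuclideanSpace ℝ (Fin n)) (hz : z ≠ 0) :
    lap (hker α b) z = 0 := by
  set p : ℝ := -(n:ℝ)/2 with hp
  have hS : ∀ (j : Fin n) (z : EuclideanSpace ℝ (Fin n)),
      HasDerivAt (fun t : ℝ => ‖z + t • EuclideanSpace.single j (1:ℝ)‖ ^ 2) (2 * z j) 0 := by
    intro j z
    have hl : HasDerivAt (fun t : ℝ => z + t • EuclideanSpace.single j (1:ℝ))
        (EuclideanSpace.single j (1:ℝ)) 0 := by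
      simpa using ((hasDerivAt_id (0:ℝ)).smul_const (EuclideanSpace.single j (1:ℝ))).const_add z
    have := hl.norm_sq
    simpa [EuclideanSpace.inner_single_right] using this
  have hI : ∀ (j : Fin n) (z : EuclideanSpace ℝ (Fin n)),
      HasDerivAt (fun t : ℝ => inner ℝ b (z + t • EuclideanSpace.single j (1:ℝ))) (b j) 0 := by
    intro j z
    have : ∀ t : ℝ, inner ℝ b (z + t • EuclideanSpace.single j (1:ℝ)) = inner ℝ b z + t * b j := by
      intro t
      rw [inner_add_right, inner_smul_right, EuclideanSpace.inner_single_right]; simp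
    simp only [this]
    simpa using ((hasDerivAt_id (0:ℝ)).mul_const (b j)).const_add (inner ℝ b z)
  have hZ : ∀ (j : Fin n) (z : EuclideanSpace ℝ (Fin n)),
      HasDerivAt (fun t : ℝ => (z + t • EuclideanSpace.single j (1:ℝ)) j) 1 0 := by
    intro j z
    simpa using (hasDerivAt_id (0:ℝ)).const_add (z j)
  have hf1 : ∀ (j : Fin n) (z : EuclideanSpace ℝ (Fin n)), z ≠ 0 →
      fderiv ℝ (hker α b) z (EuclideanSpace.single j 1) =
        (α * (2 * z j) + b j) * (‖z‖^2)^p + (α * ‖z‖^2 + inner ℝ b z) *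
          (2 * z j * p * (‖z‖^2)^(p-1)) := by
    intro j z hz
    have hd := (hker_contDiffAt α b z hz).differentiableAt (by simp)
    rw [← hd.lineDeriv_eq_fderiv]
    apply HasLineDerivAt.lineDeriv
    unfold HasLineDerivAt
    have h1 := (((hS j z).const_mul α).add (hI j z)).mul
      ((hS j z).rpow_const (p := p) (by left; simpa using hz))
    unfold hker
    simp only [norm_pow_inv_eq]
    convert! h1 using 1
    simp
  unfold lap
  have hmain : ∀ j : Fin n, fderiv ℝ (fun y => fderiv ℝ (hker α b) y (EuclideanSpace.single j 1)) z
      (EuclideanSpace.single j 1) =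
      2 * α * (‖z‖^2)^p + 2 * ((α * (2 * z j) + b j) * (2 * z j * p * (‖z‖^2)^(p-1)))
       + (α * ‖z‖^2 + inner ℝ b z) * (2 * p * (‖z‖^2)^(p-1)
          + 2 * z j * p * (2 * z j * (p-1) * (‖z‖^2)^(p-1-1))) := by
    intro j
    have hd : DifferentiableAt ℝ (fun y => fderiv ℝ (hker α b) y (EuclideanSpace.single j 1)) z :=
      (((hker_contDiffAt α b z hz).fderiv_right (m := 1) (by norm_num)).differentiableAt
        (by simp)).clm_apply (by fun_prop)
    rw [← hd.lineDeriv_eq_fderiv]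
    apply HasLineDerivAt.lineDeriv
    unfold HasLineDerivAt
    have hnz : ∀ᶠ t : ℝ in 𝓝 0, z + t • EuclideanSpace.single j (1:ℝ) ≠ 0 := by
      have hc : Continuous (fun t : ℝ => z + t • EuclideanSpace.single j (1:ℝ)) := by fun_prop
      exact hc.continuousAt.eventually_ne (by simpa using hz)
    have h0 : ‖z + (0:ℝ) • EuclideanSpace.single j (1:ℝ)‖ ^ 2 ≠ 0 := by simpa using hz
    have h1 := ((((hZ j z).const_mul 2).const_mul α).add_const (b j)).mul
      ((hS j z).rpow_const (p := p) (Or.inl h0))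
    have h2 := (((hS j z).const_mul α).add (hI j z)).mul
      ((((hZ j z).const_mul 2).mul_const p).mul ((hS j z).rpow_const (p := p-1) (Or.inl h0)))
    have h3 := h1.add h2
    refine HasDerivAt.congr_of_eventuallyEq (f := _) ?_ (hnz.mono fun t ht => hf1 j _ ht)
    convert! h3 using 1
    simp
    ring
  simp only [hmain]
  have hs : 0 < ‖z‖^2 := by positivity
  have e1 : (‖z‖^2)^p = ‖z‖^2 * ‖z‖^2 * (‖z‖^2)^(p-1-1) := by
    rw [Real.rpow_sub_one hs.ne', Real.rpow_sub_one hs.ne']; field_simp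
  have e2 : (‖z‖^2)^(p-1) = ‖z‖^2 * (‖z‖^2)^(p-1-1) := by
    rw [Real.rpow_sub_one hs.ne' (p-1)]; field_simp
  rw [e1, e2]
  set Q := (‖z‖^2)^(p-1-1)
  have hzz : ∑ j, z j * z j = ‖z‖^2 := by
    rw [EuclideanSpace.norm_sq_eq]; simp [sq]
  have hbz : ∑ j, b j * z j = inner ℝ b z := by
    simp [PiLp.inner_apply, mul_comm]
  set s := ‖z‖^2
  set β := inner ℝ b z
  have : ∀ j : Fin n, 2 * α * (s * s * Q) + 2 * ((α * (2 * z j) + b j) * (2 * z j * p * (s * Q))) +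
        (α * s + β) * (2 * p * (s * Q) + 2 * z j * p * (2 * z j * (p - 1) * Q))
      = (2 * α * s * s * Q + (α * s + β) * (2 * p * s * Q))
        + (8 * α * p * s * Q + (α * s + β) * (4 * p * (p-1) * Q)) * (z j * z j)
        + (4 * p * s * Q) * (b j * z j) := by intro j; ring
  simp only [this]
  rw [Finset.sum_add_distrib, Finset.sum_add_distrib, ← Finset.mul_sum, ← Finset.mul_sum, hzz, hbz]
  simp only [Finset.sum_const, Finset.card_univ, Fintype.card_fin, nsmul_eq_mul]
  have hn : (n:ℝ) = -2 * p := by rw [hp]; ring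
  rw [hn]; ring

lemma hker_harm {n : ℕ} (α : ℝ) (b a : EuclideanSpace ℝ (Fin n))
    (U : Set (EuclideanSpace ℝ (Fin n))) (ha : a ∉ U) :
    HarmonicOn (fun x => hker α b (x - a)) U := by
  constructor
  · intro x hx
    have hxa : x - a ≠ 0 := sub_ne_zero.2 fun h => ha (h ▸ hx)
    exact ((hker_contDiffAt α b _ hxa).comp x (contDiffAt_id.sub contDiffAt_const)).contDiffWithinAt
  · intro x hx
    have hxa : x - a ≠ 0 := sub_ne_zero.2 fun h => ha (h ▸ hx)
    rw [← hker_lap α b _ hxa]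
    unfold lap
    refine Finset.sum_congr rfl fun j _ => ?_
    simp only [fderiv_comp_sub]
    rw [fderiv_comp_sub (f := fun y => fderiv ℝ (hker α b) y (EuclideanSpace.single j 1))]

lemma sing_integrableOn {n : ℕ} (hn : 2 ≤ n) (r : ℝ) :
    IntegrableOn (fun z : EuclideanSpace ℝ (Fin n) => (‖z‖ ^ (n-1))⁻¹) (ball 0 r) := by
  have : Nontrivial (EuclideanSpace ℝ (Fin n)) := by
    have : Nonempty (Fin n) := ⟨⟨0, by omega⟩⟩
    infer_instance
  have hfr : Module.finrank ℝ (EuclideanSpace ℝ (Fin n)) = n := by simp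
  rw [integrableOn_fun_norm_addHaar volume (f := fun t : ℝ => (t ^ (n-1))⁻¹), hfr]
  refine IntegrableOn.congr_fun (f := fun _ => (1:ℝ)) ?_ ?_ measurableSet_Ioo
  · exact integrableOn_const (by simp)
  · intro t ht
    have : t ≠ 0 := ht.1.ne'
    simp [this]

lemma hker_bound {n : ℕ} (hn : 2 ≤ n) (α : ℝ) (b z : EuclideanSpace ℝ (Fin n)) :
    |hker α b z| ≤ (|α| * ‖z‖ + ‖b‖) * (‖z‖ ^ (n-1))⁻¹ := by
  unfold hker
  by_cases hz : z = 0
  · subst hz; simp; positivity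
  have hz' : 0 < ‖z‖ := norm_pos_iff.2 hz
  obtain ⟨m, rfl⟩ : ∃ m, n = m + 1 := ⟨n-1, by omega⟩
  simp only [Nat.add_sub_cancel]
  rw [abs_mul, abs_of_nonneg (a := (‖z‖^(m+1))⁻¹) (by positivity), pow_succ ‖z‖ m, mul_inv]
  have h1 : |α * ‖z‖^2 + inner ℝ b z| ≤ (|α| * ‖z‖ + ‖b‖) * ‖z‖ := by
    refine (abs_add_le _ _).trans ?_
    rw [abs_mul, abs_of_nonneg (a := ‖z‖^2) (by positivity)]
    have := abs_real_inner_le_norm b z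
    nlinarith
  calc |α * ‖z‖^2 + inner ℝ b z| * ((‖z‖^m)⁻¹ * ‖z‖⁻¹)
      ≤ ((|α| * ‖z‖ + ‖b‖) * ‖z‖) * ((‖z‖^m)⁻¹ * ‖z‖⁻¹) :=
        mul_le_mul_of_nonneg_right h1 (by positivity)
    _ = _ := by field_simp

lemma hker_measurable {n : ℕ} (α : ℝ) (b : EuclideanSpace ℝ (Fin n)) :
    Measurable (hker α b) := by
  unfold hker; fun_prop

lemma hker_integrableOn {n : ℕ} (hn : 2 ≤ n) (α : ℝ) (b : EuclideanSpace ℝ (Fin n)) (r : ℝ) :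
    IntegrableOn (hker α b) (ball 0 r) := by
  refine Integrable.mono' ((sing_integrableOn hn r).const_mul (|α| * r + ‖b‖))
    (hker_measurable α b).aestronglyMeasurable ?_
  filter_upwards [ae_restrict_mem measurableSet_ball] with z hz
  rw [mem_ball_zero_iff] at hz
  refine (hker_bound hn α b z).trans (mul_le_mul_of_nonneg_right ?_ (by positivity))
  have := abs_nonneg α
  nlinarith

lemma hker_integrableOn_sub {n : ℕ} (hn : 2 ≤ n) (α : ℝ) (b a : EuclideanSpace ℝ (Fin n)) (r : ℝ) :
    IntegrableOn (fun x => hker α b (x - a)) (ball 0 r) := by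
  have hmp := measurePreserving_sub_right (volume : Measure (EuclideanSpace ℝ (Fin n))) a
  have h := (hmp.integrableOn_comp_preimage (measurableEmbedding_subRight a)
    (f := hker α b) (s := ball 0 (r + ‖a‖))).2 (hker_integrableOn hn α b _)
  refine IntegrableOn.mono_set h ?_
  intro x hx
  rw [mem_ball_zero_iff] at hx
  simp only [mem_preimage, mem_ball_zero_iff]
  linarith [norm_sub_le x a]

lemma hker_neg {n : ℕ} (α : ℝ) (b z : EuclideanSpace ℝ (Fin n)) :
    hker α b (-z) = hker α (-b) z := by
  simp [hker]

/-- sub mean value property on closed balls contained in `U` -/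
def SubMean {n : ℕ} (f : EuclideanSpace ℝ (Fin n) → ℝ) (U : Set (EuclideanSpace ℝ (Fin n))) : Prop :=
  ∀ x r, 0 < r → closedBall x r ⊆ U →
    volume.real (closedBall x r) * f x ≤ ∫ y in closedBall x r, f y

lemma SubMean.mono {n : ℕ} {f : EuclideanSpace ℝ (Fin n) → ℝ} {U V : Set (EuclideanSpace ℝ (Fin n))}
    (h : SubMean f U) (hV : V ⊆ U) : SubMean f V := fun x r hr hx => h x r hr (hx.trans hV)

lemma SubMean.eq_of_max {n : ℕ} {f : EuclideanSpace ℝ (Fin n) → ℝ}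
    {U : Set (EuclideanSpace ℝ (Fin n))} (h : SubMean f U) {x : EuclideanSpace ℝ (Fin n)} {r : ℝ}
    (hr : 0 < r) (hU : closedBall x r ⊆ U) (hc : ContinuousOn f (closedBall x r))
    (hm : ∀ y ∈ closedBall x r, f y ≤ f x) : ∀ y ∈ closedBall x r, f y = f x := by
  have hi : IntegrableOn f (closedBall x r) := hc.integrableOn_compact (isCompact_closedBall x r)
  have hic : IntegrableOn (fun _ => f x) (closedBall x r) :=
    integrableOn_const measure_closedBall_lt_top.ne
  have hi2 : IntegrableOn (fun y => f x - f y) (closedBall x r) :=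
    hic.sub hi
  have h0 : 0 ≤ᵐ[volume.restrict (closedBall x r)] (fun y => f x - f y) := by
    filter_upwards [ae_restrict_mem measurableSet_closedBall] with y hy
    simpa using hm y hy
  have h1 : ∫ y in closedBall x r, (f x - f y) = 0 := by
    apply le_antisymm _ (integral_nonneg_of_ae h0)
    rw [integral_sub hic hi]
    have := h x r hr hU
    simp only [integral_const, smul_eq_mul, measureReal_restrict_apply MeasurableSet.univ,
      univ_inter]
    linarith
  rw [integral_eq_zero_iff_of_nonneg_ae h0 hi2] at h1
  have h2 := Measure.eqOn_of_ae_eq h1 (continuousOn_const.sub hc) continuousOn_const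
    (by rw [interior_closedBall _ hr.ne', closure_ball _ hr.ne'])
  intro y hy
  have := h2 hy
  simp at this
  linarith

lemma weak_max {n : ℕ} (hn : 2 ≤ n) {f : EuclideanSpace ℝ (Fin n) → ℝ}
    {C : Set (EuclideanSpace ℝ (Fin n))} (hC : IsOpen C) (hb : Bornology.IsBounded C)
    (hc : ContinuousOn f (closure C)) (h : SubMean f C) (hf : ∀ x ∈ frontier C, f x ≤ 0) :
    ∀ x ∈ C, f x ≤ 0 := by
  intro x0 hx0
  by_contra! hpos
  have hcomp : IsCompact (closure C) := hb.isCompact_closure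
  obtain ⟨x1, hx1, hmax⟩ := hcomp.exists_isMaxOn ⟨x0, subset_closure hx0⟩ hc
  have hm : 0 < f x1 := hpos.trans_le (hmax (subset_closure hx0))
  set M := {x ∈ closure C | f x = f x1} with hM
  have hMc : IsCompact M := by
    have : M = closure C ∩ f ⁻¹' {f x1} := by ext; simp [hM]
    rw [this]
    exact hcomp.of_isClosed_subset (hc.preimage_isClosed_of_isClosed isClosed_closure isClosed_singleton)
      inter_subset_left
  set j : Fin n := ⟨0, by omega⟩
  have hcont : Continuous (fun x : EuclideanSpace ℝ (Fin n) => x j) := by fun_prop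
  obtain ⟨z, hz, hzmax⟩ := hMc.exists_isMaxOn ⟨x1, hx1, rfl⟩ hcont.continuousOn
  have hzC : z ∈ C := by
    by_contra hzC
    have : z ∈ frontier C := by
      rw [hC.frontier_eq]; exact ⟨hz.1, hzC⟩
    have h3 := hf z this
    rw [hz.2] at h3; linarith
  obtain ⟨r, hr, hrC⟩ := nhds_basis_closedBall.mem_iff.1 (hC.mem_nhds hzC)
  have hsub : closedBall z r ⊆ closure C := hrC.trans subset_closure
  have heq := h.eq_of_max hr hrC (hc.mono hsub) (fun y hy => by rw [hz.2]; exact hmax (hsub hy))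
  have hy : z + EuclideanSpace.single j r ∈ closedBall z r := by
    simp [abs_of_pos hr]
  have hy2 : z + EuclideanSpace.single j r ∈ M := ⟨hsub hy, by rw [heq _ hy, hz.2]⟩
  have := hzmax hy2
  simp at this
  linarith

lemma strong_max {n : ℕ} {f : EuclideanSpace ℝ (Fin n) → ℝ}
    {U : Set (EuclideanSpace ℝ (Fin n))} (hU : IsOpen U) (hconn : IsPreconnected U)
    (hc : ContinuousOn f U) (h : SubMean f U) (hf : ∀ x ∈ U, f x ≤ 0)
    {x0 : EuclideanSpace ℝ (Fin n)} (hx0 : x0 ∈ U) (h0 : f x0 = 0) : ∀ x ∈ U, f x = 0 := by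
  have key : U ⊆ {x ∈ U | f x = 0} := by
    refine hconn.subset_of_closure_inter_subset ?_ ⟨x0, hx0, hx0, h0⟩ ?_
    · rw [isOpen_iff_mem_nhds]
      rintro x ⟨hx, hfx⟩
      obtain ⟨r, hr, hrC⟩ := nhds_basis_closedBall.mem_iff.1 (hU.mem_nhds hx)
      have heq := h.eq_of_max hr hrC (hc.mono hrC) (fun y hy => by rw [hfx]; exact hf y (hrC hy))
      filter_upwards [closedBall_mem_nhds x hr] with y hy
      exact ⟨hrC hy, by rw [heq y hy, hfx]⟩
    · rintro x ⟨hx, hxU⟩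
      refine ⟨hxU, ?_⟩
      have hcx : ContinuousAt f x := hc.continuousAt (hU.mem_nhds hxU)
      have := mem_closure_iff_frequently.1 hx
      by_contra hne
      exact this ((hcx.eventually_ne hne).mono fun y hy hy2 => hy hy2.2)
  exact fun x hx => (key hx).2

lemma vol_ball {n : ℕ} (hn : 2 ≤ n) (c : EuclideanSpace ℝ (Fin n)) (r : ℝ) (hr : 0 ≤ r) :
    volume.real (ball c r) = r ^ n * volume.real (ball (0 : EuclideanSpace ℝ (Fin n)) 1) := by
  have : Nontrivial (EuclideanSpace ℝ (Fin n)) := by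
    have : Nonempty (Fin n) := ⟨⟨0, by omega⟩⟩
    infer_instance
  have := Measure.addHaar_ball (volume : Measure (EuclideanSpace ℝ (Fin n))) c hr
  simp [measureReal_def, this, ENNReal.toReal_mul, hr]

lemma vol_pos {n : ℕ} (c : EuclideanSpace ℝ (Fin n)) (r : ℝ) (hr : 0 < r) :
    0 < volume.real (ball c r) := by
  have := measure_ball_pos volume c hr
  exact ENNReal.toReal_pos this.ne' (by finiteness)

lemma rhon_pos (n : ℕ) : 0 < rhon n := by unfold rhon; positivity

lemma rhon_pow {n : ℕ} (hn : 2 ≤ n) : rhon n ^ n = 1/2 := by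
  unfold rhon
  have : (n:ℝ) ≠ 0 := by positivity
  rw [← Real.rpow_natCast, ← Real.rpow_mul (by norm_num), div_mul_cancel₀ _ this]
  norm_num [Real.rpow_neg_one]

lemma rhon_lt {n : ℕ} (hn : 2 ≤ n) : rhon n < 1 := by
  by_contra! h
  have := one_le_pow₀ h (n := n)
  rw [rhon_pow hn] at this; norm_num at this

lemma setInt_closedBall {n : ℕ} (hn : 2 ≤ n) (f : EuclideanSpace ℝ (Fin n) → ℝ)
    (c : EuclideanSpace ℝ (Fin n)) (r : ℝ) : ∫ y in closedBall c r, f y = ∫ y in ball c r, f y := by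
  have : Nontrivial (EuclideanSpace ℝ (Fin n)) := by
    have : Nonempty (Fin n) := ⟨⟨0, by omega⟩⟩
    infer_instance
  refine setIntegral_congr_set ?_
  exact (ae_eq_of_subset_of_measure_ge ball_subset_closedBall
    (Measure.addHaar_closedBall_eq_addHaar_ball volume c r).le
    measurableSet_ball.nullMeasurableSet measure_closedBall_lt_top.ne).symm

lemma vol_closedBall {n : ℕ} (hn : 2 ≤ n) 
    (c : EuclideanSpace ℝ (Fin n)) (r : ℝ) : volume.real (closedBall c r) = volume.real (ball c r) := by
  have : Nontrivial (EuclideanSpace ℝ (Fin n)) := by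
    have : Nonempty (Fin n) := ⟨⟨0, by omega⟩⟩
    infer_instance
  exact Measure.addHaar_real_closedBall_eq_addHaar_real_ball _ _ _

/-- the difference is sub-mean -/
lemma subMean_diff {n : ℕ} (hn : 2 ≤ n) (ω h : EuclideanSpace ℝ (Fin n) → ℝ)
    (hωc : ContinuousOn ω (closedBall (0 : EuclideanSpace ℝ (Fin n)) 1))
    (hωs : SubharmonicOn ω (ball (0 : EuclideanSpace ℝ (Fin n)) 1))
    (hhc : ContinuousOn h (closedBall (0 : EuclideanSpace ℝ (Fin n)) 1))
    (hhh : HarmonicOn h (ball (0 : EuclideanSpace ℝ (Fin n)) 1)) :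
    SubMean (fun x => ω x - h x) (ball 0 1) := by
  intro x r hr hx
  have h1 := hωs.2 x (hx (mem_closedBall_self hr.le)) r hr hx
  have hx' : closedBall x r ⊆ closedBall 0 1 := hx.trans ball_subset_closedBall
  have i1 : IntegrableOn ω (closedBall x r) :=
    (hωc.mono hx').integrableOn_compact (isCompact_closedBall x r)
  have i2 : IntegrableOn h (closedBall x r) :=
    (hhc.mono hx').integrableOn_compact (isCompact_closedBall x r)
  rw [integral_sub i1 i2]
  have h2 := mvp x r hr ⟨hhh.1.mono (ball_subset_closedBall.trans hx),
    fun y hy => hhh.2 y (hx (ball_subset_closedBall hy))⟩ (i2.mono_set ball_subset_closedBall)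
  rw [setInt_closedBall hn h, h2, vol_closedBall hn]
  rw [setAverage_eq, vol_closedBall hn, smul_eq_mul, ← div_eq_inv_mul, le_div_iff₀ (vol_pos x r hr)] at h1
  linarith

lemma exists_annihilator {X : Type*} [NormedAddCommGroup X] [NormedSpace ℝ X] (M : Submodule ℝ X)
    (F : X) (h : ∀ g ∈ M, ‖F‖ ≤ ‖F - g‖) :
    ∃ φ : X →L[ℝ] ℝ, ‖φ‖ ≤ 1 ∧ (∀ g ∈ M, φ g = 0) ∧ φ F = ‖F‖ := by
  obtain ⟨g, hg1, hg2⟩ := exists_dual_vector'' ℝ (Submodule.Quotient.mk F : X ⧸ M)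
  have hn : ‖(Submodule.Quotient.mk F : X ⧸ M)‖ = ‖F‖ := by
    apply le_antisymm (Submodule.Quotient.norm_mk_le M F)
    apply le_of_forall_pos_le_add
    intro ε hε
    obtain ⟨m, hm, hlt⟩ := Submodule.Quotient.norm_mk_lt (Submodule.Quotient.mk F : X ⧸ M) hε
    rw [Submodule.Quotient.eq] at hm
    have := h (F - m) (by rw [← neg_mem_iff]; simpa using hm)
    simp at this
    linarith
  refine ⟨LinearMap.mkContinuous (g.toLinearMap ∘ₗ M.mkQ) 1 ?_, ?_, ?_, ?_⟩
  · intro x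
    have h1 := g.le_opNorm (Submodule.Quotient.mk x)
    have h2 := Submodule.Quotient.norm_mk_le M x
    have h3 : 0 ≤ ‖(Submodule.Quotient.mk x : X ⧸ M)‖ := norm_nonneg _
    simp only [LinearMap.coe_comp, Function.comp_apply, Submodule.mkQ_apply, one_mul]
    refine le_trans h1 ?_
    nlinarith
  · exact LinearMap.mkContinuous_norm_le _ zero_le_one _
  · intro x hx
    simp [(Submodule.Quotient.mk_eq_zero M).2 hx]
  · simp [hg2, hn]

lemma L1_dual {Ω : Type*} [MeasurableSpace Ω] (μ : Measure Ω) [IsFiniteMeasure μ]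
    (φ : Lp ℝ 1 μ →L[ℝ] ℝ) (hφ : ‖φ‖ ≤ 1) :
    ∃ s : Ω → ℝ, Measurable s ∧ (∀ x, |s x| ≤ 1) ∧
      ∀ (g : Ω → ℝ) (hg : MemLp g 1 μ), MemLp g 2 μ → φ (hg.toLp g) = ∫ x, g x * s x ∂μ := by
  have h12 : (1:ℝ≥0∞) ≤ 2 := by norm_num
  have hmem : ∀ g : Lp ℝ 2 μ, MemLp g 1 μ := fun g => (Lp.memLp g).mono_exponent h12
  let ψ₀ : Lp ℝ 2 μ →ₗ[ℝ] ℝ :=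
    { toFun := fun g => φ ((hmem g).toLp g)
      map_add' := by
        intro f g
        rw [← map_add, ← MemLp.toLp_add]
        congr 1
        exact MemLp.toLp_congr _ _ (Lp.coeFn_add f g)
      map_smul' := by
        intro c f
        rw [RingHom.id_apply, ← map_smul, ← MemLp.toLp_const_smul]
        congr 1
        exact MemLp.toLp_congr _ _ (Lp.coeFn_smul c f) }
  let K : ℝ := (μ Set.univ ^ (1 / (1:ℝ≥0∞).toReal - 1 / (2:ℝ≥0∞).toReal)).toReal
  have hb : ∀ g, ‖ψ₀ g‖ ≤ K * ‖g‖ := by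
    intro g
    have h1 := φ.le_opNorm ((hmem g).toLp g)
    have h2 : ‖(hmem g).toLp g‖ ≤ K * ‖g‖ := by
      rw [Lp.norm_toLp, Lp.norm_def, mul_comm, ← ENNReal.toReal_mul]
      refine ENNReal.toReal_mono ?_ (eLpNorm_le_eLpNorm_mul_rpow_measure_univ h12
        (Lp.aestronglyMeasurable g))
      refine ENNReal.mul_ne_top (Lp.eLpNorm_ne_top g) ?_
      refine ENNReal.rpow_ne_top_of_nonneg ?_ (measure_ne_top _ _)
      norm_num
    refine le_trans h1 (le_trans ?_ h2)
    have := norm_nonneg ((hmem g).toLp g)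
    nlinarith
  let ψ : Lp ℝ 2 μ →L[ℝ] ℝ := ψ₀.mkContinuous K hb
  let s0 : Lp ℝ 2 μ := (InnerProductSpace.toDual ℝ (Lp ℝ 2 μ)).symm ψ
  have hrep : ∀ (g : Ω → ℝ) (hg : MemLp g 1 μ), MemLp g 2 μ →
      φ (hg.toLp g) = ∫ x, g x * s0 x ∂μ := by
    intro g hg hg2
    have h1 : inner ℝ s0 (hg2.toLp g) = ψ (hg2.toLp g) :=
      InnerProductSpace.toDual_symm_apply
    have h2 : ψ (hg2.toLp g) = φ (hg.toLp g) := by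
      change φ _ = _
      congr 1
      exact MemLp.toLp_congr _ _ hg2.coeFn_toLp
    rw [← h2, ← h1, L2.inner_def]
    refine integral_congr_ae ?_
    filter_upwards [hg2.coeFn_toLp] with x hx
    simp [hx]
  have hsm : Measurable s0 := (Lp.stronglyMeasurable s0).measurable
  set A : Set Ω := {x | 1 < |s0 x|} with hA
  have hAm : MeasurableSet A := measurableSet_lt measurable_const (measurable_norm.comp hsm)
  set g : Ω → ℝ := A.indicator (fun x => (SignType.sign (s0 x) : ℝ)) with hgdef
  have hgm : Measurable g := by
    refine Measurable.indicator ?_ hAm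
    have : (fun x => (SignType.sign (s0 x) : ℝ)) = 
      fun x => if 0 < s0 x then 1 else if s0 x < 0 then -1 else 0 := by
      funext x
      rw [sign_apply]
      split_ifs <;> simp
    rw [this]
    refine Measurable.ite (measurableSet_lt measurable_const hsm) measurable_const
      (Measurable.ite (measurableSet_lt hsm measurable_const) measurable_const measurable_const)
  have hg1 : ∀ x, ‖g x‖ = A.indicator (fun _ => (1:ℝ)) x := by
    intro x
    by_cases hx : x ∈ A
    · simp only [hgdef, indicator_of_mem hx]
      have : s0 x ≠ 0 := by
        intro h0; simp [hA, h0] at hx; linarith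
      rcases lt_or_gt_of_ne this with h | h <;> simp [h]
    · simp [hgdef, indicator_of_notMem hx]
  have hgb : ∀ x, ‖g x‖ ≤ 1 := by
    intro x; rw [hg1]; exact indicator_le_self' (f := fun _ => (1:ℝ)) (by simp) x
  have hgL : ∀ p, MemLp g p μ := fun p =>
    MemLp.of_bound hgm.aestronglyMeasurable 1 (Eventually.of_forall hgb)
  have hint : ∫ x, g x * s0 x ∂μ ≤ ∫ x, A.indicator (fun _ => (1:ℝ)) x ∂μ := by
    rw [← hrep g (hgL 1) (hgL 2)]
    have h1 := φ.le_opNorm ((hgL 1).toLp g)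
    have h2 : ‖(hgL 1).toLp g‖ = ∫ x, A.indicator (fun _ => (1:ℝ)) x ∂μ := by
      rw [L1.norm_eq_integral_norm]
      refine integral_congr_ae ?_
      filter_upwards [(hgL 1).coeFn_toLp] with x hx
      rw [hx, hg1]
    have := norm_nonneg ((hgL 1).toLp g)
    calc _ ≤ ‖φ ((hgL 1).toLp g)‖ := le_abs_self _
      _ ≤ _ := h1
      _ ≤ ‖(hgL 1).toLp g‖ := by nlinarith
      _ = _ := h2
  have hs0i : Integrable s0 μ := memLp_one_iff_integrable.1 (hmem s0)
  have hgs : ∀ x, g x * s0 x = A.indicator (fun x => |s0 x|) x := by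
    intro x
    by_cases hx : x ∈ A
    · simp only [hgdef, indicator_of_mem hx]
      rw [sign_mul_self]
    · simp [hgdef, indicator_of_notMem hx]
  simp only [hgs] at hint
  rw [integral_indicator hAm, integral_indicator hAm] at hint
  have hz : ∫ x in A, (|s0 x| - 1) ∂μ = 0 := by
    apply le_antisymm
    · rw [integral_sub hs0i.abs.integrableOn (integrable_const _)]
      linarith
    · refine setIntegral_nonneg hAm fun x hx => ?_
      have : 1 < |s0 x| := hx
      linarith
  have hAnull : ∀ᵐ x ∂μ, |s0 x| ≤ 1 := by
    have hnn : 0 ≤ᵐ[μ.restrict A] fun x => |s0 x| - 1 := by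
      filter_upwards [ae_restrict_mem hAm] with x hx
      have : 1 < |s0 x| := hx
      simp; linarith
    rw [integral_eq_zero_iff_of_nonneg_ae hnn (hs0i.abs.integrableOn.sub (integrable_const _))] at hz
    have := (ae_restrict_iff' hAm).1 hz
    filter_upwards [this] with x hx
    by_contra! hc
    have := hx hc
    simp at this; linarith
  refine ⟨fun x => max (-1) (min 1 (s0 x)), by fun_prop, fun x => abs_le.2 ⟨le_max_left _ _, 
    max_le (by norm_num) (min_le_left _ _)⟩, fun g hg hg2 => ?_⟩
  rw [hrep g hg hg2]
  refine integral_congr_ae ?_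
  filter_upwards [hAnull] with x hx
  rw [abs_le] at hx
  rw [min_eq_right hx.2, max_eq_right hx.1]

lemma duality {n : ℕ} (f : EuclideanSpace ℝ (Fin n) → ℝ)
    (hf : ContinuousOn f (closedBall 0 1))
    (hbest : ∀ u : EuclideanSpace ℝ (Fin n) → ℝ, HarmonicOn u (ball 0 1) →
      IntegrableOn u (ball 0 1) → (∫ x in ball 0 1, |f x|) ≤ ∫ x in ball 0 1, |f x - u x|) :
    ∃ s : EuclideanSpace ℝ (Fin n) → ℝ, Measurable s ∧ (∀ x, |s x| ≤ 1) ∧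
      (∀ u, HarmonicOn u (ball 0 1) → ContinuousOn u (closedBall 0 1) →
        ∫ x in ball 0 1, u x * s x = 0) ∧
      ∫ x in ball 0 1, f x * s x = ∫ x in ball 0 1, |f x| := by
  set B : Set (EuclideanSpace ℝ (Fin n)) := ball 0 1 with hB
  set μ : Measure (EuclideanSpace ℝ (Fin n)) := volume.restrict B with hμ
  have hBfin : volume B < ∞ := measure_ball_lt_top
  have : IsFiniteMeasure μ := ⟨by simpa [hμ] using hBfin⟩
  have hcm : ∀ u : EuclideanSpace ℝ (Fin n) → ℝ, ContinuousOn u (closedBall 0 1) →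
      ∀ p, MemLp u p μ := by
    intro u hu p
    obtain ⟨C, hC⟩ := (isCompact_closedBall (0:EuclideanSpace ℝ (Fin n)) 1).exists_bound_of_continuousOn hu
    refine MemLp.of_bound ((hu.mono ball_subset_closedBall).aestronglyMeasurable measurableSet_ball) C ?_
    filter_upwards [ae_restrict_mem measurableSet_ball] with x hx
    exact hC x (ball_subset_closedBall hx)
  let M : Submodule ℝ (Lp ℝ 1 μ) :=
    { carrier := {g | ∃ u, HarmonicOn u B ∧ g =ᵐ[μ] u}
      add_mem' := by
        rintro a b ⟨u, hu, hau⟩ ⟨v, hv, hbv⟩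
        refine ⟨_, HarmonicOn.lin isOpen_ball 1 hu hv, ?_⟩
        filter_upwards [hau, hbv, Lp.coeFn_add a b] with x h1 h2 h3
        rw [h3, Pi.add_apply, h1, h2, one_mul]
      zero_mem' := ⟨_, HarmonicOn.const 0 B, by
        filter_upwards [Lp.coeFn_zero ℝ 1 μ] with x hx
        rw [hx]; rfl⟩
      smul_mem' := by
        rintro c a ⟨u, hu, hau⟩
        refine ⟨_, HarmonicOn.lin isOpen_ball c (HarmonicOn.const 0 B) hu, ?_⟩
        filter_upwards [hau, Lp.coeFn_smul c a] with x h1 h3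
        simp [h1, h3] }
  have hf1 := hcm f hf 1
  obtain ⟨φ, hφ1, hφM, hφf⟩ := exists_annihilator M (hf1.toLp f) (by
    rintro g ⟨u, hu, hgu⟩
    have hi : IntegrableOn u B := (L1.integrable_coeFn g).congr hgu
    have := hbest u hu hi
    rw [L1.norm_eq_integral_norm, L1.norm_eq_integral_norm]
    refine le_trans (le_of_eq ?_) (this.trans (le_of_eq ?_))
    · refine integral_congr_ae ?_
      filter_upwards [hf1.coeFn_toLp] with x hx
      simp [hx]
    · refine integral_congr_ae ?_
      filter_upwards [hf1.coeFn_toLp, hgu, Lp.coeFn_sub (hf1.toLp f) g] with x h1 h2 h3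
      rw [h3, Pi.sub_apply, h1, h2, Real.norm_eq_abs])
  obtain ⟨s, hsm, hs1, hs⟩ := L1_dual μ φ hφ1
  refine ⟨s, hsm, hs1, ?_, ?_⟩
  · intro u hu huc
    rw [← hs u (hcm u huc 1) (hcm u huc 2)]
    exact hφM _ ⟨u, hu, (hcm u huc 1).coeFn_toLp⟩
  · rw [← hs f hf1 (hcm f hf 2), hφf, L1.norm_eq_integral_norm]
    refine integral_congr_ae ?_
    filter_upwards [hf1.coeFn_toLp] with x hx
    simp [hx]

/-- properties of the dual density -/
structure IsDens {n : ℕ} (f σ : EuclideanSpace ℝ (Fin n) → ℝ) : Prop where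
  meas : Measurable σ
  nonneg : ∀ x, 0 ≤ σ x
  le_two : ∀ x, σ x ≤ 2
  supp : ∀ x, σ x ≠ 0 → x ∈ closedBall (0 : EuclideanSpace ℝ (Fin n)) 1 ∧ f x ≤ 0
  eq_two : ∀ x ∈ closedBall (0 : EuclideanSpace ℝ (Fin n)) 1, f x < 0 → σ x = 2
  int_eq : ∀ u, HarmonicOn u (ball 0 1) → ContinuousOn u (closedBall 0 1) →
    ∫ x, σ x * u x = volume.real (ball (0 : EuclideanSpace ℝ (Fin n)) 1) * u 0

lemma exists_dens {n : ℕ} (hn : 2 ≤ n) (f : EuclideanSpace ℝ (Fin n) → ℝ)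
    (hf : ContinuousOn f (closedBall 0 1))
    (hbest : ∀ u : EuclideanSpace ℝ (Fin n) → ℝ, HarmonicOn u (ball 0 1) →
      IntegrableOn u (ball 0 1) → (∫ x in ball 0 1, |f x|) ≤ ∫ x in ball 0 1, |f x - u x|) :
    ∃ σ, IsDens f σ := by
  classical
  obtain ⟨s, hsm, hs1, hsu, hsf⟩ := duality f hf hbest
  have hcl : IsClosed (closedBall (0:EuclideanSpace ℝ (Fin n)) 1) := isClosed_closedBall
  set K := closedBall (0:EuclideanSpace ℝ (Fin n)) 1 ∩ f ⁻¹' Iic 0 with hK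
  have hKc : IsClosed K := hf.preimage_isClosed_of_isClosed hcl isClosed_Iic
  set Q := closedBall (0:EuclideanSpace ℝ (Fin n)) 1 ∩ f ⁻¹' Ici 0 with hQ
  have hQc : IsClosed Q := hf.preimage_isClosed_of_isClosed hcl isClosed_Ici
  set σ : EuclideanSpace ℝ (Fin n) → ℝ := fun x => if x ∈ K then (if x ∈ Q then 1 - s x else 2) else 0
    with hσ
  have hmeas : Measurable σ := Measurable.ite hKc.measurableSet
    (Measurable.ite hQc.measurableSet (measurable_const.sub hsm) measurable_const) measurable_const
  have hcm : ∀ u : EuclideanSpace ℝ (Fin n) → ℝ, ContinuousOn u (closedBall 0 1) →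
      IntegrableOn u (ball 0 1) := fun u hu =>
    (hu.integrableOn_compact (isCompact_closedBall _ _)).mono_set ball_subset_closedBall
  have hms : ∀ u : EuclideanSpace ℝ (Fin n) → ℝ, ContinuousOn u (closedBall 0 1) →
      IntegrableOn (fun x => u x * s x) (ball 0 1) := by
    intro u hu
    refine (hcm u hu).mul_bdd (c := 1) hsm.aestronglyMeasurable ?_
    exact Eventually.of_forall hs1
  have hae : ∀ᵐ x ∂(volume.restrict (ball (0:EuclideanSpace ℝ (Fin n)) 1)), f x * s x = |f x| := by
    have hle : ∀ x, f x * s x ≤ |f x| := by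
      intro x
      calc f x * s x ≤ |f x * s x| := le_abs_self _
        _ = |f x| * |s x| := abs_mul _ _
        _ ≤ |f x| * 1 := mul_le_mul_of_nonneg_left (hs1 x) (abs_nonneg _)
        _ = _ := mul_one _
    have h0 : ∫ x in ball (0:EuclideanSpace ℝ (Fin n)) 1, (|f x| - f x * s x) = 0 := by
      rw [integral_sub (hcm f hf).abs (hms f hf), hsf, sub_self]
    rw [integral_eq_zero_iff_of_nonneg_ae (Eventually.of_forall fun x => sub_nonneg.2 (hle x))
      ((hcm f hf).abs.sub (hms f hf))] at h0
    filter_upwards [h0] with x hx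
    simp at hx; linarith
  refine ⟨σ, hmeas, ?_, ?_, ?_, ?_, ?_⟩
  · intro x; have := abs_le.1 (hs1 x)
    simp only [hσ]; split_ifs <;> linarith
  · intro x; have := abs_le.1 (hs1 x)
    simp only [hσ]; split_ifs <;> linarith
  · intro x hx
    by_contra hc
    apply hx
    exact if_neg hc
  · intro x hx hfx
    simp only [hσ]
    rw [if_pos ⟨hx, hfx.le⟩, if_neg]
    rintro ⟨-, h2⟩
    exact absurd hfx (not_lt.2 h2)
  · intro u hu huc
    have h1 : ∫ x, σ x * u x = ∫ x in closedBall 0 1, σ x * u x := by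
      symm
      apply setIntegral_eq_integral_of_forall_compl_eq_zero
      intro x hx
      simp only [hσ]; rw [if_neg fun h => hx h.1, zero_mul]
    rw [h1, setInt_closedBall hn]
    have h2 : ∫ x in ball 0 1, σ x * u x = ∫ x in ball 0 1, (u x - u x * s x) := by
      refine integral_congr_ae ?_
      filter_upwards [hae, ae_restrict_mem measurableSet_ball] with x hx hxb
      have hxc := ball_subset_closedBall hxb
      simp only [hσ]
      rcases lt_trichotomy (f x) 0 with h | h | h
      · rw [if_pos ⟨hxc, h.le⟩, if_neg fun hq => absurd h (not_lt.2 hq.2)]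
        have : s x = -1 := by
          rw [abs_of_neg h] at hx
          have : f x * (s x + 1) = 0 := by linarith
          rcases mul_eq_zero.1 this with h3 | h3 <;> linarith
        rw [this]; ring
      · rw [if_pos ⟨hxc, h.le⟩, if_pos ⟨hxc, h.ge⟩]; ring
      · rw [if_neg fun hq => absurd h (not_lt.2 hq.2)]
        have : s x = 1 := by
          rw [abs_of_pos h] at hx
          have : f x * (s x - 1) = 0 := by linarith
          rcases mul_eq_zero.1 this with h3 | h3 <;> linarith
        rw [this]; ring
    rw [h2, integral_sub (hcm u huc) (hms u huc), hsu u hu huc, sub_zero, mvp 0 1 one_pos hu (hcm u huc)]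

lemma binom_cont {K : Type*} [TopologicalSpace K] [CompactSpace K] [Nonempty K] (p : ℝ) :
    ∃ g : C(K, ℝ) → C(K, ℝ), AnalyticAt ℝ g 0 ∧ ∀ θ : C(K, ℝ), ‖θ‖ < 1 →
      ∀ x, g θ x = (1 + θ x) ^ p := by
  have hrad : 1 ≤ (binomialSeries C(K, ℝ) p).radius := by
    refine le_trans (binomialSeries_radius_ge_one (𝔸 := ℝ) (a := p)) ?_
    refine FormalMultilinearSeries.radius_le_of_le fun n => ?_
    unfold binomialSeries
    rw [FormalMultilinearSeries.ofScalars_norm, FormalMultilinearSeries.ofScalars_norm]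
  have hfp := (binomialSeries C(K, ℝ) p).hasFPowerSeriesOnBall (lt_of_lt_of_le zero_lt_one hrad)
  refine ⟨(binomialSeries C(K, ℝ) p).sum, hfp.analyticAt, fun θ hθ x => ?_⟩
  have hmem : θ ∈ Metric.eball (0 : C(K, ℝ)) (binomialSeries C(K, ℝ) p).radius := by
    rw [Metric.mem_eball, edist_zero_right]
    refine lt_of_lt_of_le ?_ hrad
    rw [← ofReal_norm, ENNReal.ofReal_lt_one]
    exact hθ
  have h1 := hfp.hasSum_sub hmem
  have hθx : θ x ∈ Metric.eball (0 : ℝ) 1 := by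
    rw [Metric.mem_eball, edist_zero_right, ← ofReal_norm, ENNReal.ofReal_lt_one]
    exact (θ.norm_coe_le_norm x).trans_lt hθ
  have h2 := (Real.one_add_rpow_hasFPowerSeriesOnBall_zero (a := p)).hasSum_sub hθx
  have h3 := h1.map (ContinuousMap.evalCLM ℝ x : C(K, ℝ) →L[ℝ] ℝ) (ContinuousLinearMap.continuous _)
  refine HasSum.unique h3 ?_
  have h4 : (⇑(ContinuousMap.evalCLM ℝ x : C(K, ℝ) →L[ℝ] ℝ) ∘ fun n =>
      (binomialSeries C(K, ℝ) p n) fun _ => θ - 0) =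
      (fun n => (binomialSeries ℝ p n) fun _ => θ x - 0) := by
    funext k
    simp only [Function.comp_apply, binomialSeries_apply, List.ofFn_const, List.prod_replicate, sub_zero]
    simp
  rw [h4]
  exact h2

lemma potential_analytic {n : ℕ} (K : Set (EuclideanSpace ℝ (Fin n))) (hK : IsCompact K)
    (hne : K.Nonempty) (σ : EuclideanSpace ℝ (Fin n) → ℝ) (hσm : Measurable σ)
    (hσ0 : ∀ x, |σ x| ≤ 2) (hσK : ∀ x, σ x ≠ 0 → x ∈ K)
    (α : ℝ) (b y0 : EuclideanSpace ℝ (Fin n)) (hy0 : y0 ∉ K) :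
    AnalyticAt ℝ (fun y => ∫ x, σ x * hker α b (x - y)) y0 := by
  have : CompactSpace K := isCompact_iff_compactSpace.1 hK
  have : Nonempty K := hne.to_subtype
  obtain ⟨g, hg, hgx⟩ := binom_cont (K := K) (-(n:ℝ)/2)
  set μ : Measure K := volume.comap ((↑) : K → EuclideanSpace ℝ (Fin n)) with hμ
  have hμfin : IsFiniteMeasure μ := by
    constructor
    rw [hμ, comap_subtype_coe_apply hK.measurableSet]
    simpa using hK.measure_lt_top
  have hint : ∀ φ : C(K, ℝ), Integrable (fun x : K => σ x * φ x) μ := by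
    intro φ
    refine Integrable.of_bound (C := 2 * ‖φ‖) ?_ ?_
    · exact ((hσm.comp measurable_subtype_coe).mul φ.continuous.measurable).aestronglyMeasurable
    · refine Eventually.of_forall fun x => ?_
      rw [norm_mul]
      exact mul_le_mul (hσ0 x) (φ.norm_coe_le_norm x) (norm_nonneg _) (by norm_num)
  let Λ : C(K, ℝ) →L[ℝ] ℝ := LinearMap.mkContinuous
    { toFun := fun φ => ∫ x : K, σ x * φ x ∂μ
      map_add' := by
        intro φ ψ
        rw [← integral_add (hint φ) (hint ψ)]
        simp [mul_add]
      map_smul' := by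
        intro c φ
        simp only [RingHom.id_apply, smul_eq_mul]
        rw [← integral_const_mul]
        congr 1; funext x; simp; ring } (2 * μ.real univ) (by
        intro φ
        have := norm_integral_le_of_norm_le_const (μ := μ) (f := fun x : K => σ x * φ x) (C := 2 * ‖φ‖) (by
          refine Eventually.of_forall fun x => ?_
          rw [norm_mul]
          exact mul_le_mul (hσ0 x) (φ.norm_coe_le_norm x) (norm_nonneg _) (by norm_num))
        refine this.trans (le_of_eq (by ring)))
  have hΛ : ∀ φ : C(K, ℝ), Λ φ = ∫ x : K, σ x * φ x ∂μ := fun φ => rfl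
  let cj : Fin n → C(K, ℝ) := fun j => ⟨fun x => (x : EuclideanSpace ℝ (Fin n)) j, by fun_prop⟩
  let A : EuclideanSpace ℝ (Fin n) → C(K, ℝ) := fun y => ∑ j, (cj j - y j • 1) ^ 2
  let I : EuclideanSpace ℝ (Fin n) → C(K, ℝ) := fun y => ∑ j, b j • (cj j - y j • 1)
  have hcoord : ∀ j, AnalyticAt ℝ (fun y : EuclideanSpace ℝ (Fin n) => cj j - y j • (1 : C(K,ℝ))) y0 := by
    intro j
    refine analyticAt_const.sub (AnalyticAt.fun_smul ?_ analyticAt_const)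
    exact (EuclideanSpace.proj j : EuclideanSpace ℝ (Fin n) →L[ℝ] ℝ).analyticAt y0
  have hAan : AnalyticAt ℝ A y0 := by
    refine Finset.analyticAt_fun_sum _ fun j _ => (hcoord j).pow 2
  have hIan : AnalyticAt ℝ I y0 := by
    refine Finset.analyticAt_fun_sum _ fun j _ => analyticAt_const.fun_smul (hcoord j)
  have hAx : ∀ y (x : K), A y x = ‖(x : EuclideanSpace ℝ (Fin n)) - y‖ ^ 2 := by
    intro y x
    rw [EuclideanSpace.norm_sq_eq]
    simp [A, cj, ContinuousMap.sum_apply]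
  have hIx : ∀ y (x : K), I y x = inner ℝ b ((x : EuclideanSpace ℝ (Fin n)) - y) := by
    intro y x
    simp [I, cj, ContinuousMap.sum_apply, PiLp.inner_apply, mul_comm]
  have hpos : ∀ x : K, 0 < A y0 x := by
    intro x
    rw [hAx]
    have : (x : EuclideanSpace ℝ (Fin n)) - y0 ≠ 0 := sub_ne_zero.2 fun h => hy0 (h ▸ x.2)
    positivity
  let w : C(K, ℝ) := ⟨fun x => (A y0 x)⁻¹, (A y0).continuous.inv₀ fun x => (hpos x).ne'⟩
  let wp : C(K, ℝ) := ⟨fun x => (A y0 x) ^ (-(n:ℝ)/2), (A y0).continuous.rpow_const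
    fun x => Or.inl (hpos x).ne'⟩
  let θ : EuclideanSpace ℝ (Fin n) → C(K, ℝ) := fun y => w * (A y - A y0)
  have hθan : AnalyticAt ℝ θ y0 := analyticAt_const.mul (hAan.sub analyticAt_const)
  have hθ0 : θ y0 = 0 := by simp [θ]
  have hG : AnalyticAt ℝ (fun y => Λ ((α • A y + I y) * (wp * g (θ y)))) y0 := by
    have h1 : AnalyticAt ℝ (fun y => g (θ y)) y0 := by
      refine AnalyticAt.comp (g := g) (f := θ) ?_ hθan
      rw [hθ0]; exact hg
    have h2 := ((analyticAt_const (v := α)).smul hAan).add hIan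
    have h3 := h2.mul ((analyticAt_const (v := wp)).mul h1)
    exact (Λ.analyticAt _).comp h3
  refine hG.congr ?_
  have hev : ∀ᶠ y in 𝓝 y0, ‖θ y‖ < 1 := by
    have : ContinuousAt (fun y => ‖θ y‖) y0 := hθan.continuousAt.norm
    refine this.eventually_lt continuousAt_const ?_
    simp [hθ0]
  filter_upwards [hev] with y hy
  rw [hΛ]
  have e1 : ∫ x, σ x * hker α b (x - y) = ∫ x in K, σ x * hker α b (x - y) := by
    symm
    apply setIntegral_eq_integral_of_forall_compl_eq_zero
    intro x hx
    have : σ x = 0 := by by_contra h; exact hx (hσK x h)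
    rw [this, zero_mul]
  rw [e1, ← integral_subtype_comap hK.measurableSet (fun x => σ x * hker α b (x - y))]
  refine integral_congr_ae (Eventually.of_forall fun x => ?_)
  simp only [ContinuousMap.mul_apply, ContinuousMap.add_apply, ContinuousMap.smul_apply, smul_eq_mul]
  rw [hgx _ hy, hIx]
  have e2 : wp x * (1 + θ y x) ^ (-(n:ℝ)/2) = (A y x) ^ (-(n:ℝ)/2) := by
    have h1 : -1 < θ y x := by
      have := (abs_le.1 ((θ y).norm_coe_le_norm x)).1
      linarith
    change (A y0 x) ^ (-(n:ℝ)/2) * (1 + θ y x) ^ (-(n:ℝ)/2) = _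
    rw [← Real.mul_rpow (hpos x).le (by linarith)]
    congr 1
    change A y0 x * (1 + (A y0 x)⁻¹ * (A y x - A y0 x)) = _
    have := (hpos x).ne'
    field_simp
    ring
  rw [e2, hAx]
  unfold hker
  rw [norm_pow_inv_eq]

lemma hker_analyticAt {n : ℕ} (α : ℝ) (b z : EuclideanSpace ℝ (Fin n)) (hz : z ≠ 0) :
    AnalyticAt ℝ (hker α b) z := by
  refine ContDiffAt.analyticAt ?_
  unfold hker
  have h1 : ContDiffAt ℝ ⊤ (fun z : EuclideanSpace ℝ (Fin n) => ‖z‖) z := contDiffAt_norm ℝ hz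
  have h2 : ContDiffAt ℝ ⊤ (fun z : EuclideanSpace ℝ (Fin n) => inner ℝ b z) z :=
    contDiffAt_const.inner ℝ contDiffAt_id
  exact ((contDiffAt_const.mul (h1.pow 2)).add h2).mul
    ((h1.pow n).inv (pow_ne_zero n (norm_ne_zero_iff.2 hz)))

/-- the potential -/
noncomputable def pot {n : ℕ} (σ : EuclideanSpace ℝ (Fin n) → ℝ) (α : ℝ)
    (b y : EuclideanSpace ℝ (Fin n)) : ℝ :=
  (∫ x, σ x * hker α b (x - y)) -
    volume.real (ball (0 : EuclideanSpace ℝ (Fin n)) 1) * hker α b (-y)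

lemma IsDens.pot_ext {n : ℕ} {f σ : EuclideanSpace ℝ (Fin n) → ℝ}
    (hσ : IsDens f σ) (α : ℝ) (b y : EuclideanSpace ℝ (Fin n)) (hy : 1 < ‖y‖) : pot σ α b y = 0 := by
  have hy' : y ∉ closedBall (0 : EuclideanSpace ℝ (Fin n)) 1 := by simpa using hy
  have := hσ.int_eq (fun x => hker α b (x - y))
    (hker_harm α b y _ fun h => hy' (ball_subset_closedBall h))
    ((hker_harm α b y _ hy').1.continuousOn)
  unfold pot
  rw [this, zero_sub, sub_self]

lemma IsDens.supp_abs {n : ℕ} {f σ : EuclideanSpace ℝ (Fin n) → ℝ}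
    (hσ : IsDens f σ) (x) : |σ x| ≤ 2 := by
  rw [abs_of_nonneg (hσ.nonneg x)]; exact hσ.le_two x

/-- the compact set where `f ≤ 0` -/
def Kset {n : ℕ} (f : EuclideanSpace ℝ (Fin n) → ℝ) : Set (EuclideanSpace ℝ (Fin n)) :=
  closedBall 0 1 ∩ f ⁻¹' Iic 0

lemma Kset_compact {n : ℕ} {f : EuclideanSpace ℝ (Fin n) → ℝ}
    (hf : ContinuousOn f (closedBall 0 1)) : IsCompact (Kset f) :=
  (isCompact_closedBall _ _).of_isClosed_subset
    (hf.preimage_isClosed_of_isClosed isClosed_closedBall isClosed_Iic) inter_subset_left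

lemma IsDens.Kset_nonempty {n : ℕ} {f σ : EuclideanSpace ℝ (Fin n) → ℝ}
    (hσ : IsDens f σ) : (Kset f).Nonempty := by
  by_contra hne
  rw [not_nonempty_iff_eq_empty] at hne
  have h0 : ∀ x, σ x = 0 := by
    intro x
    by_contra h
    have : x ∈ Kset f := hσ.supp x h
    rw [hne] at this; exact this
  have := hσ.int_eq (fun _ => 1) (HarmonicOn.const 1 _) continuousOn_const
  simp [h0] at this
  exact (vol_pos (0 : EuclideanSpace ℝ (Fin n)) 1 one_pos).ne' this.symm

lemma IsDens.unique_cont {n : ℕ} (hn : 2 ≤ n) {f σ : EuclideanSpace ℝ (Fin n) → ℝ}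
    (hσ : IsDens f σ) (hf : ContinuousOn f (closedBall 0 1)) (C : Set (EuclideanSpace ℝ (Fin n)))
    (hC : IsPreconnected C) (hCK : ∀ x ∈ C, x ∉ Kset f) (hCo : IsOpen C)
    (z : EuclideanSpace ℝ (Fin n)) (hz : z ∈ C)
    (hz1 : 1 < ‖z‖) : (0 : EuclideanSpace ℝ (Fin n)) ∉ C ∧ ∀ α b, ∀ y ∈ C, pot σ α b y = 0 := by
  have hev : ∀ᶠ y in 𝓝 z, 1 < ‖y‖ := continuousAt_const.eventually_lt continuous_norm.continuousAt hz1
  have hpa : ∀ α b, ∀ y ∈ C, AnalyticAt ℝ (fun y => ∫ x, σ x * hker α b (x - y)) y :=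
    fun α b y hy => potential_analytic (Kset f) (Kset_compact hf) hσ.Kset_nonempty σ hσ.meas
      hσ.supp_abs hσ.supp α b y (hCK y hy)
  set β := volume.real (ball (0 : EuclideanSpace ℝ (Fin n)) 1) with hβ
  have hβpos : 0 < β := vol_pos _ _ one_pos
  have h0 : (0 : EuclideanSpace ℝ (Fin n)) ∉ C := by
    intro h0
    set e : EuclideanSpace ℝ (Fin n) := EuclideanSpace.single ⟨0, by omega⟩ 1 with he
    have hee : ‖e‖ = 1 := by simp [he]
    set Φ := fun y => ∫ x, σ x * hker 0 e (x - y) with hΦ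
    have hzE : EqOn (fun y : EuclideanSpace ℝ (Fin n) => Φ y ^ 2 * (‖y‖ ^ 2) ^ n - β ^ 2 * (inner ℝ e y) ^ 2) 0 C := by
      refine AnalyticOnNhd.eqOn_zero_of_preconnected_of_eventuallyEq_zero (𝕜 := ℝ) (z₀ := z) ?_ hC hz ?_
      · intro y hy
        have h1 : AnalyticAt ℝ (fun y : EuclideanSpace ℝ (Fin n) => ‖y‖ ^ 2) y := by
          refine ContDiffAt.analyticAt ?_
          exact (contDiff_norm_sq ℝ).contDiffAt
        have h2 : AnalyticAt ℝ (fun y : EuclideanSpace ℝ (Fin n) => (inner ℝ e y : ℝ)) y :=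
          (innerSL ℝ e).analyticAt y
        exact (((hpa 0 e y hy).pow 2).mul (h1.pow n)).sub (analyticAt_const.mul (h2.pow 2))
      · filter_upwards [hev] with y hy
        have := hσ.pot_ext 0 e y hy
        unfold pot at this
        have h3 : Φ y = β * hker 0 e (-y) := by simp only [hΦ]; linarith
        have hy0 : ‖y‖ ≠ 0 := by linarith
        simp only [Pi.zero_apply]
        rw [h3]
        unfold hker
        simp only [norm_neg, inner_neg_right, zero_mul, zero_add]
        field_simp
        ring
    have hcont : ContinuousAt (fun t : ℝ => Φ (t • e)) 0 := by
      have h1 : ContinuousAt Φ ((0:ℝ) • e) := by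
        rw [zero_smul]; exact (hpa 0 e 0 h0).continuousAt
      exact ContinuousAt.comp (f := fun t : ℝ => t • e) h1 (by fun_prop)
    have hlim : Tendsto (fun t : ℝ => Φ (t • e) ^ 2 * t ^ (2 * n - 2)) (𝓝[≠] 0) (𝓝 0) := by
      have h2 : ContinuousAt (fun t : ℝ => Φ (t • e) ^ 2 * t ^ (2 * n - 2)) 0 :=
        (hcont.pow 2).mul (continuousAt_id.pow _)
      have h3 := h2.tendsto
      rw [zero_pow (by omega), mul_zero] at h3
      exact h3.mono_left nhdsWithin_le_nhds
    have hlim2 : Tendsto (fun t : ℝ => Φ (t • e) ^ 2 * t ^ (2 * n - 2)) (𝓝[≠] 0) (𝓝 (β ^ 2)) := by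
      refine tendsto_const_nhds.congr' ?_
      have hev2 : ∀ᶠ t : ℝ in 𝓝 0, t • e ∈ C := by
        have : ContinuousAt (fun t : ℝ => t • e) 0 := by fun_prop
        exact this.eventually_mem (by rw [zero_smul]; exact hCo.mem_nhds h0)
      filter_upwards [nhdsWithin_le_nhds hev2, self_mem_nhdsWithin] with t ht ht0
      have ht0' : t ≠ 0 := ht0
      have h4 := hzE ht
      simp only [Pi.zero_apply] at h4
      rw [norm_smul, hee, mul_one, inner_smul_right, real_inner_self_eq_norm_sq, hee, Real.norm_eq_abs,
        sq_abs, ← pow_mul] at h4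
      have h5 : t ^ (2 * n) = t ^ (2 * n - 2) * t ^ 2 := by
        rw [← pow_add]; congr 1; omega
      rw [h5] at h4
      have h6 : (Φ (t • e) ^ 2 * t ^ (2 * n - 2) - β ^ 2) * t ^ 2 = 0 := by linarith
      rcases mul_eq_zero.1 h6 with h7 | h7
      · linarith
      · exact absurd (pow_eq_zero_iff (by norm_num) |>.1 h7) ht0'
    have := tendsto_nhds_unique hlim hlim2
    have := pow_pos hβpos 2
    linarith
  refine ⟨h0, fun α b => ?_⟩
  suffices h : EqOn (pot σ α b) 0 C from fun y hy => h hy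
  refine AnalyticOnNhd.eqOn_zero_of_preconnected_of_eventuallyEq_zero (𝕜 := ℝ) (z₀ := z) ?_ hC hz ?_
  · intro y hy
    refine (hpa α b y hy).sub (analyticAt_const.mul ?_)
    have hy0 : -y ≠ 0 := by
      rw [neg_ne_zero]; rintro rfl; exact h0 hy
    exact (hker_analyticAt α b (-y) hy0).comp (analyticAt_id.neg)
  · filter_upwards [hev] with y hy
    exact hσ.pot_ext α b y hy

lemma IsDens.pot_pos {n : ℕ} (hn : 2 ≤ n) {f σ : EuclideanSpace ℝ (Fin n) → ℝ}
    (hσ : IsDens f σ) (hf : ContinuousOn f (closedBall 0 1)) (hsub : SubMean f (ball 0 1))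
    (y : EuclideanSpace ℝ (Fin n)) (hy : ‖y‖ ≤ 1) (hfy : 0 < f y) :
    y ≠ 0 ∧ ∀ α b, pot σ α b y = 0 := by
  set Ω := (Kset f)ᶜ with hΩ
  have hΩo : IsOpen Ω := (Kset_compact hf).isClosed.isOpen_compl
  have hyΩ : y ∈ Ω := fun h => absurd hfy (not_lt.2 h.2)
  set C := connectedComponentIn Ω y with hC
  have hCo : IsOpen C := hΩo.connectedComponentIn
  have hCc : IsPreconnected C := isPreconnected_connectedComponentIn
  have hyC : y ∈ C := mem_connectedComponentIn hyΩ
  have hCΩ : C ⊆ Ω := connectedComponentIn_subset _ _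
  have hex : ∃ z ∈ C, 1 < ‖z‖ := by
    by_contra! hcon
    have h1 : C ⊆ closedBall 0 1 := fun z hz => by simpa using hcon z hz
    have h2 : C ⊆ ball 0 1 := by
      have := interior_maximal h1 hCo
      rwa [interior_closedBall _ one_ne_zero] at this
    have h3 : closure C ⊆ closedBall 0 1 := closure_minimal h1 isClosed_closedBall
    have h4 : ∀ z ∈ frontier C, f z ≤ 0 := by
      intro z hz
      rw [hCo.frontier_eq] at hz
      by_contra! hfz
      have hzΩ : z ∈ Ω := fun h => absurd hfz (not_lt.2 h.2)
      have h5 : IsPreconnected (insert z C) :=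
        hCc.subset_closure (subset_insert _ _) (insert_subset hz.1 subset_closure)
      exact hz.2 (h5.subset_connectedComponentIn (mem_insert_of_mem _ hyC)
        (insert_subset hzΩ hCΩ) (mem_insert _ _))
    have h6 := weak_max hn hCo (isBounded_closedBall.subset h1) (hf.mono h3) (hsub.mono h2) h4 y hyC
    linarith
  obtain ⟨z, hz, hz1⟩ := hex
  obtain ⟨h0, h⟩ := hσ.unique_cont hn hf C hCc hCΩ hCo z hz hz1
  exact ⟨fun h' => h0 (h' ▸ hyC), fun α b => h α b y hyC⟩

lemma bdd_int_hker {n : ℕ} (hn : 2 ≤ n) {σ : EuclideanSpace ℝ (Fin n) → ℝ}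
    (hm : Measurable σ) (hb : ∀ x, |σ x| ≤ 2) (hs : ∀ x, σ x ≠ 0 → ‖x‖ ≤ 1)
    (α : ℝ) (b y : EuclideanSpace ℝ (Fin n)) :
    Integrable (fun x => σ x * hker α b (x - y)) := by
  have h1 : IntegrableOn (fun x => σ x * hker α b (x - y)) (ball 0 2) :=
    (hker_integrableOn_sub hn α b y 2).bdd_mul hm.aestronglyMeasurable (Eventually.of_forall hb)
  rw [integrableOn_iff_integrable_of_support_subset] at h1
  · exact h1
  · intro x hx
    have : σ x ≠ 0 := fun h => hx (by simp [h])
    have := hs x this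
    simp; linarith

lemma IsDens.supp_norm {n : ℕ} {f σ : EuclideanSpace ℝ (Fin n) → ℝ}
    (hσ : IsDens f σ) (x) (hx : σ x ≠ 0) : ‖x‖ ≤ 1 := by
  simpa using (hσ.supp x hx).1

lemma IsDens.int_hker {n : ℕ} (hn : 2 ≤ n) {f σ : EuclideanSpace ℝ (Fin n) → ℝ}
    (hσ : IsDens f σ) (α : ℝ) (b y : EuclideanSpace ℝ (Fin n)) :
    Integrable (fun x => σ x * hker α b (x - y)) :=
  bdd_int_hker hn hσ.meas hσ.supp_abs hσ.supp_norm α b y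

lemma IsDens.integrable {n : ℕ} {f σ : EuclideanSpace ℝ (Fin n) → ℝ}
    (hσ : IsDens f σ) : Integrable σ := by
  have h1 : IntegrableOn σ (closedBall 0 1) := by
    refine Measure.integrableOn_of_bounded (M := 2) measure_closedBall_lt_top.ne
      hσ.meas.aestronglyMeasurable (Eventually.of_forall hσ.supp_abs)
  rw [integrableOn_iff_integrable_of_support_subset] at h1
  · exact h1
  · intro x hx
    exact (hσ.supp x hx).1

lemma IsDens.pos_norm {n : ℕ} (hn : 2 ≤ n) {f σ : EuclideanSpace ℝ (Fin n) → ℝ}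
    (hσ : IsDens f σ) (hf : ContinuousOn f (closedBall 0 1)) (hsub : SubMean f (ball 0 1))
    (y : EuclideanSpace ℝ (Fin n)) (hy : ‖y‖ ≤ 1) (hfy : 0 < f y) : rhon n ≤ ‖y‖ := by
  obtain ⟨hy0, hpot⟩ := hσ.pot_pos hn hf hsub y hy hfy
  have hr : 0 < ‖y‖ := norm_pos_iff.2 hy0
  set β := volume.real (ball (0 : EuclideanSpace ℝ (Fin n)) 1) with hβ
  have hβpos : 0 < β := vol_pos _ _ one_pos
  set q := fun x => hker 1 ((2:ℝ) • y) (x - y) with hq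
  have hqx : ∀ x, q x = (‖x‖^2 - ‖y‖^2) * (‖x - y‖ ^ n)⁻¹ := by
    intro x
    simp only [hq, hker]
    congr 1
    rw [norm_sub_sq_real, inner_smul_left, inner_sub_right, real_inner_self_eq_norm_sq,
      real_inner_comm]
    simp; ring
  have h1 : ∫ x, σ x * q x = β * q 0 := by
    have := hpot 1 ((2:ℝ) • y)
    unfold pot at this
    simp only [hq, zero_sub]; linarith
  have h2 : ∫ x in ball 0 ‖y‖, q x = volume.real (ball (0 : EuclideanSpace ℝ (Fin n)) ‖y‖) * q 0 :=
    mvp 0 ‖y‖ hr (hker_harm _ _ _ _ (by simp)) (hker_integrableOn_sub hn _ _ _ _)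
  have hind : Integrable ((ball (0 : EuclideanSpace ℝ (Fin n)) ‖y‖).indicator (fun x => 2 * q x)) := by
    rw [integrable_indicator_iff measurableSet_ball]
    exact (hker_integrableOn_sub hn _ _ _ _).const_mul 2
  have h3 : ∫ x, (ball (0 : EuclideanSpace ℝ (Fin n)) ‖y‖).indicator (fun x => 2 * q x) x
      ≤ ∫ x, σ x * q x := by
    refine integral_mono hind (hσ.int_hker hn _ _ _) fun x => ?_
    by_cases hx : x ∈ ball (0 : EuclideanSpace ℝ (Fin n)) ‖y‖
    · rw [indicator_of_mem hx]
      have hx' : ‖x‖ < ‖y‖ := by simpa using hx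
      have hq0 : q x ≤ 0 := by
        rw [hqx]
        refine mul_nonpos_of_nonpos_of_nonneg ?_ (by positivity)
        nlinarith [norm_nonneg x]
      have := hσ.le_two x
      change 2 * q x ≤ σ x * q x
      nlinarith
    · rw [indicator_of_notMem hx]
      have hx' : ‖y‖ ≤ ‖x‖ := by simpa using hx
      refine mul_nonneg (hσ.nonneg x) ?_
      change 0 ≤ q x
      rw [hqx]
      refine mul_nonneg ?_ (by positivity)
      nlinarith [norm_nonneg x]
  rw [integral_indicator measurableSet_ball, integral_const_mul, h2, h1, vol_ball hn _ _ hr.le] at h3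
  have hq0 : q 0 < 0 := by
    rw [hqx]
    simp only [norm_zero, zero_sub, norm_neg]
    have : 0 < (‖y‖^n)⁻¹ := by positivity
    have : 0 < ‖y‖^2 := by positivity
    nlinarith
  have h4 : 1/2 ≤ ‖y‖^n := by
    by_contra! hlt
    have : 0 < β * (-q 0) := mul_pos hβpos (by linarith)
    nlinarith
  rw [← rhon_pow hn] at h4
  exact (pow_le_pow_iff_left₀ (rhon_pos n).le hr.le (by omega)).1 h4

lemma annulus_pt {n : ℕ} (hn : 2 ≤ n) {f : EuclideanSpace ℝ (Fin n) → ℝ}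
    (hf : ContinuousOn f (closedBall 0 1)) (x : EuclideanSpace ℝ (Fin n))
    (hx : ‖x‖ ≤ 1) (hx2 : rhon n ≤ ‖x‖) (hfx : f x < 0) :
    ∃ z, rhon n < ‖z‖ ∧ ‖z‖ < 1 ∧ f z < 0 := by
  have hxm : x ∈ closedBall (0 : EuclideanSpace ℝ (Fin n)) 1 := by simpa using hx
  have h1 := (hf x hxm).eventually_lt continuousWithinAt_const hfx
  obtain ⟨δ, hδ, h2⟩ := Metric.mem_nhdsWithin_iff.1 h1
  have h3 : ‖x‖ ∈ closure (Ioo (rhon n) 1) := by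
    rw [closure_Ioo (rhon_lt hn).ne]; exact ⟨hx2, hx⟩
  obtain ⟨s, hs, hsd⟩ := Metric.mem_closure_iff.1 h3 δ hδ
  have hxp : 0 < ‖x‖ := (rhon_pos n).trans_le hx2
  have hsp : 0 < s := (rhon_pos n).trans hs.1
  have hz : ‖(s / ‖x‖) • x‖ = s := by
    rw [norm_smul, Real.norm_eq_abs, abs_of_pos (by positivity)]; field_simp
  refine ⟨(s / ‖x‖) • x, by rw [hz]; exact hs.1, by rw [hz]; exact hs.2, h2 ⟨?_, ?_⟩⟩
  · rw [mem_ball, dist_eq_norm]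
    have : (s / ‖x‖) • x - x = ((s - ‖x‖) / ‖x‖) • x := by
      rw [sub_div, sub_smul, div_self hxp.ne', one_smul]
    rw [this, norm_smul, Real.norm_eq_abs, abs_div, abs_of_pos hxp, div_mul_cancel₀ _ hxp.ne', abs_sub_comm]
    exact hsd
  · simp [hz, hs.2.le]

lemma IsDens.case_neg {n : ℕ} (hn : 2 ≤ n) {f σ : EuclideanSpace ℝ (Fin n) → ℝ}
    (hσ : IsDens f σ) (hf : ContinuousOn f (closedBall 0 1))
    (hneg : ∀ x ∈ ball (0 : EuclideanSpace ℝ (Fin n)) (rhon n), f x < 0)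
    (z : EuclideanSpace ℝ (Fin n)) (hz1 : rhon n < ‖z‖) (hz2 : ‖z‖ < 1) (hfz : f z < 0) : False := by
  have hzm : closedBall (0 : EuclideanSpace ℝ (Fin n)) 1 ∈ 𝓝 z :=
    mem_of_superset (isOpen_ball.mem_nhds (by simpa using hz2)) ball_subset_closedBall
  have h1 : ∀ᶠ w in 𝓝 z, w ∈ closedBall (0 : EuclideanSpace ℝ (Fin n)) 1 ∧ f w < 0 ∧ rhon n < ‖w‖ := by
    filter_upwards [hzm, (hf.continuousAt hzm).eventually_lt continuousAt_const hfz,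
      continuousAt_const.eventually_lt continuous_norm.continuousAt hz1] with w a b c
    exact ⟨a, b, c⟩
  obtain ⟨ε, hε, h2⟩ := Metric.mem_nhds_iff.1 h1
  have h3 := hσ.int_eq (fun _ => 1) (HarmonicOn.const 1 _) continuousOn_const
  simp only [mul_one] at h3
  set β := volume.real (ball (0 : EuclideanSpace ℝ (Fin n)) 1) with hβ
  have hd : Disjoint (ball (0 : EuclideanSpace ℝ (Fin n)) (rhon n)) (ball z ε) := by
    rw [Set.disjoint_left]
    intro w hw hw2
    have := (h2 hw2).2.2
    have : ‖w‖ < rhon n := by simpa using hw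
    linarith
  set S := ball (0 : EuclideanSpace ℝ (Fin n)) (rhon n) ∪ ball z ε with hS
  have hSm : MeasurableSet S := measurableSet_ball.union measurableSet_ball
  have hSf : volume S ≠ ∞ := (measure_union_lt_top measure_ball_lt_top measure_ball_lt_top).ne
  have h4 : ∫ x, S.indicator (fun _ => (2:ℝ)) x ≤ ∫ x, σ x := by
    refine integral_mono ((integrable_indicator_iff hSm).2 (integrableOn_const hSf)) hσ.integrable fun x => ?_
    by_cases hx : x ∈ S
    · rw [indicator_of_mem hx]
      rcases hx with hx | hx
      · rw [hσ.eq_two x (ball_subset_closedBall (ball_subset_ball (rhon_lt hn).le hx)) (hneg x hx)]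
      · rw [hσ.eq_two x (h2 hx).1 (h2 hx).2.1]
    · rw [indicator_of_notMem hx]; exact hσ.nonneg x
  rw [integral_indicator hSm, h3, setIntegral_const, hS, measureReal_union hd measurableSet_ball
    measure_ball_lt_top.ne measure_ball_lt_top.ne,
    vol_ball hn _ _ (rhon_pos n).le, rhon_pow hn, ← hβ, smul_eq_mul] at h4
  have := vol_pos z ε hε
  linarith

lemma conv_cont {n : ℕ} {σ G : EuclideanSpace ℝ (Fin n) → ℝ}
    (hm : Measurable σ) (hb : ∀ x, |σ x| ≤ 2) (hi : Integrable σ) (hG : Integrable G) :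
    Continuous fun y => ∫ x, σ x * G (x - y) := by
  refine continuous_of_uniform_approx_of_continuous fun u hu => ?_
  obtain ⟨ε, hε, hεu⟩ := Metric.mem_uniformity_dist.1 hu
  obtain ⟨φ, hφs, hφ, hφc, hφi⟩ := hG.exists_hasCompactSupport_integral_sub_le (ε := ε/4) (by positivity)
  obtain ⟨C, hC⟩ := hφs.exists_bound_of_continuous hφc
  have hint : ∀ g : EuclideanSpace ℝ (Fin n) → ℝ, Integrable g → ∀ y,
      Integrable fun x => σ x * g (x - y) := fun g hg y =>
    (hg.comp_sub_right y).bdd_mul hm.aestronglyMeasurable (Eventually.of_forall hb)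
  refine ⟨fun y => ∫ x, σ x * φ (x - y), ?_, fun y => hεu ?_⟩
  · refine continuous_of_dominated (bound := fun x => |σ x| * C) (fun y => (hint φ hφi y).aestronglyMeasurable)
      (fun y => Eventually.of_forall fun x => ?_) (hi.abs.mul_const C)
      (Eventually.of_forall fun x => by fun_prop)
    rw [norm_mul]
    exact mul_le_mul_of_nonneg_left (hC _) (abs_nonneg _)
  · rw [Real.dist_eq, ← integral_sub (hint G hG y) (hint φ hφi y)]
    have h1 : ‖∫ x, (σ x * G (x - y) - σ x * φ (x - y))‖ ≤ ∫ x, 2 * ‖G (x - y) - φ (x - y)‖ := by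
      refine norm_integral_le_of_norm_le (((hG.sub hφi).norm.const_mul 2).comp_sub_right y)
        (Eventually.of_forall fun x => ?_)
      rw [← mul_sub, norm_mul]
      exact mul_le_mul_of_nonneg_right (hb x) (norm_nonneg _)
    rw [integral_const_mul, integral_sub_right_eq_self (fun x => ‖G x - φ x‖) y] at h1
    rw [Real.norm_eq_abs] at h1
    linarith

lemma IsDens.pot_cont {n : ℕ} (hn : 2 ≤ n) {f σ : EuclideanSpace ℝ (Fin n) → ℝ}
    (hσ : IsDens f σ) (α : ℝ) (b y : EuclideanSpace ℝ (Fin n)) (hy : y ≠ 0) :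
    ContinuousAt (pot σ α b) y := by
  unfold pot
  refine ContinuousAt.sub ?_ (continuousAt_const.mul ?_)
  · set R := ‖y‖ + 1
    set G := (ball (0 : EuclideanSpace ℝ (Fin n)) (R+2)).indicator (hker α b)
    have hG : Integrable G := by
      rw [integrable_indicator_iff measurableSet_ball]; exact hker_integrableOn hn α b _
    refine (conv_cont hσ.meas hσ.supp_abs hσ.integrable hG).continuousAt.congr ?_
    have : ∀ᶠ z in 𝓝 y, ‖z‖ < R :=
      continuous_norm.continuousAt.eventually_lt continuousAt_const (by simp [R])
    filter_upwards [this] with z hz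
    refine integral_congr_ae (Eventually.of_forall fun x => ?_)
    by_cases hx : σ x = 0
    · simp [hx]
    · have h1 := hσ.supp_norm x hx
      have : x - z ∈ ball (0 : EuclideanSpace ℝ (Fin n)) (R+2) := by
        rw [mem_ball_zero_iff]
        have := norm_sub_le x z
        linarith
      simp only [G]
      rw [indicator_of_mem this]
  · have := (hker_contDiffAt α b (-y) (by simpa using hy)).continuousAt
    exact ContinuousAt.comp (f := fun y => -y) (g := hker α b) this continuous_neg.continuousAt

/-- The two-point kernel with affine direction field. -/
noncomputable def Jk {n : ℕ} (c b0 : EuclideanSpace ℝ (Fin n)) (l : ℝ)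
    (x y : EuclideanSpace ℝ (Fin n)) : ℝ := hker 0 (b0 + l • (y - c)) (x - y)

lemma Jk_eq {n : ℕ} (c b0 : EuclideanSpace ℝ (Fin n)) (l : ℝ)
    (x y : EuclideanSpace ℝ (Fin n)) :
    Jk c b0 l x y = hker (-l) (-(b0 + l • (x - c))) (y - x) := by
  unfold Jk hker
  rw [norm_sub_rev x y]
  congr 1
  have h1 : b0 + l • (y - c) = (b0 + l • (x - c)) + l • (y - x) := by
    module
  rw [h1, ← neg_sub y x, inner_neg_right, inner_add_left, inner_neg_left,
    inner_smul_left, real_inner_self_eq_norm_sq]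
  simp only [conj_trivial]; ring

lemma Jk_symm {n : ℕ} (c b0 : EuclideanSpace ℝ (Fin n)) (l : ℝ)
    (x y : EuclideanSpace ℝ (Fin n)) :
    Jk c b0 l x y + Jk c b0 l y x = -l * (‖x - y‖ ^ 2 * (‖x - y‖ ^ n)⁻¹) := by
  rw [Jk_eq c b0 l x y]
  unfold Jk hker
  rw [norm_sub_rev y x, inner_neg_left]
  ring

lemma Jk_meas {n : ℕ} (c b0 : EuclideanSpace ℝ (Fin n)) (l : ℝ) :
    Measurable fun p : EuclideanSpace ℝ (Fin n) × EuclideanSpace ℝ (Fin n) => Jk c b0 l p.1 p.2 := by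
  unfold Jk hker; fun_prop

lemma Jk_integrableOn {n : ℕ} (hn : 2 ≤ n) (c b0 : EuclideanSpace ℝ (Fin n)) (l t : ℝ)
    (x : EuclideanSpace ℝ (Fin n)) : IntegrableOn (Jk c b0 l x) (ball c t) := by
  have h1 : Jk c b0 l x = fun y => hker (-l) (-(b0 + l • (x - c))) (y - x) :=
    funext fun y => Jk_eq c b0 l x y
  rw [h1]
  refine (hker_integrableOn_sub hn _ _ _ (‖c‖ + t)).mono_set ?_
  refine ball_subset_ball' ?_
  simp [add_comm]

lemma Jk_mean {n : ℕ} (hn : 2 ≤ n) (c b0 : EuclideanSpace ℝ (Fin n)) (l t : ℝ) (ht : 0 < t)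
    (x : EuclideanSpace ℝ (Fin n)) (hx : x ∉ ball c t) :
    ∫ y in ball c t, Jk c b0 l x y = volume.real (ball c t) * hker 0 b0 (x - c) := by
  have h1 : Jk c b0 l x = fun y => hker (-l) (-(b0 + l • (x - c))) (y - x) :=
    funext fun y => Jk_eq c b0 l x y
  have h2 : HarmonicOn (Jk c b0 l x) (ball c t) := by
    rw [h1]; exact hker_harm _ _ _ _ hx
  rw [mvp c t ht h2 (Jk_integrableOn hn c b0 l t x)]
  simp [Jk]

lemma Jk_prod_int {n : ℕ} (hn : 2 ≤ n) (c b0 : EuclideanSpace ℝ (Fin n)) (l t : ℝ)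
    (hD : ball c t ⊆ closedBall 0 1) {τ : EuclideanSpace ℝ (Fin n) → ℝ}
    (hm : Measurable τ) (hb : ∀ x, |τ x| ≤ 2) (hs : ∀ x, τ x ≠ 0 → ‖x‖ ≤ 1) :
    Integrable (fun p : EuclideanSpace ℝ (Fin n) × EuclideanSpace ℝ (Fin n) => τ p.1 * Jk c b0 l p.1 p.2)
      (volume.prod (volume.restrict (ball c t))) := by
  have hmm : AEStronglyMeasurable (fun p : EuclideanSpace ℝ (Fin n) × EuclideanSpace ℝ (Fin n) =>
      τ p.1 * Jk c b0 l p.1 p.2) (volume.prod (volume.restrict (ball c t))) :=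
    ((hm.comp measurable_fst).mul (Jk_meas c b0 l)).aestronglyMeasurable
  rw [integrable_prod_iff' hmm]
  refine ⟨Eventually.of_forall fun y => bdd_int_hker hn hm hb hs 0 (b0 + l • (y - c)) y, ?_⟩
  set κ := (ball (0 : EuclideanSpace ℝ (Fin n)) 3).indicator (fun z => (‖z‖^(n-1))⁻¹) with hκ
  have hκi : Integrable κ := by
    rw [integrable_indicator_iff measurableSet_ball]; exact sing_integrableOn hn 3
  set M := ‖b0‖ + |l| * (1 + ‖c‖)
  have hm2 : AEStronglyMeasurable (fun y => ∫ x, ‖τ x * Jk c b0 l x y‖) volume :=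
    (StronglyMeasurable.integral_prod_left' (μ := volume)
      ((hm.comp measurable_fst).mul (Jk_meas c b0 l)).stronglyMeasurable.norm).aestronglyMeasurable
  have hfin : volume (ball c t) ≠ ∞ := measure_ball_lt_top.ne
  refine Measure.integrableOn_of_bounded (M := 2 * M * ∫ z, κ z) hfin hm2 ?_
  refine (ae_restrict_iff' measurableSet_ball).2 (Eventually.of_forall fun y hy => ?_)
  have hy1 : ‖y‖ ≤ 1 := by simpa using hD hy
  refine (norm_integral_le_of_norm_le (g := fun x => 2 * M * κ (x - y)) ?_ ?_).trans ?_
  · exact (hκi.comp_sub_right y).const_mul _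
  · refine Eventually.of_forall fun x => ?_
    rw [norm_norm, norm_mul, Real.norm_eq_abs, Real.norm_eq_abs]
    have hM : 0 ≤ M := by positivity
    by_cases hx : τ x = 0
    · simp only [hx, abs_zero, zero_mul]
      refine mul_nonneg (by positivity) (indicator_nonneg (fun z _ => by positivity) _)
    · have hx1 := hs x hx
      have hxy : x - y ∈ ball (0 : EuclideanSpace ℝ (Fin n)) 3 := by
        rw [mem_ball_zero_iff]; linarith [norm_sub_le x y]
      rw [hκ, indicator_of_mem hxy]
      have h1 := hker_bound hn 0 (b0 + l • (y - c)) (x - y)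
      simp only [abs_zero, zero_mul, zero_add] at h1
      have h2 : ‖b0 + l • (y - c)‖ ≤ M := by
        refine (norm_add_le _ _).trans ?_
        rw [norm_smul, Real.norm_eq_abs]
        have : ‖y - c‖ ≤ 1 + ‖c‖ := (norm_sub_le _ _).trans (by linarith)
        simp only [M]; gcongr
      calc |τ x| * |Jk c b0 l x y| ≤ 2 * (M * (‖x - y‖^(n-1))⁻¹) := by
            refine mul_le_mul (hb x) (h1.trans ?_) (abs_nonneg _) (by norm_num)
            gcongr
        _ = _ := by ring
  · rw [integral_const_mul, integral_sub_right_eq_self κ y]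

lemma Jk_DD_int {n : ℕ} (hn : 2 ≤ n) (c b0 : EuclideanSpace ℝ (Fin n)) (l t : ℝ)
    (hD : ball c t ⊆ closedBall 0 1) :
    Integrable (fun p : EuclideanSpace ℝ (Fin n) × EuclideanSpace ℝ (Fin n) => Jk c b0 l p.1 p.2)
      ((volume.restrict (ball c t)).prod (volume.restrict (ball c t))) := by
  have h := Jk_prod_int hn c b0 l t hD (τ := (ball c t).indicator (fun _ => 1))
    (measurable_const.indicator measurableSet_ball)
    (fun x => by by_cases hx : x ∈ ball c t <;> simp [indicator, hx])
    (fun x hx => by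
      have : x ∈ ball c t := by by_contra h; simp [indicator, h] at hx
      simpa using hD this)
  have h2 : (volume.restrict (ball c t)).prod (volume.restrict (ball c t)) =
    ((volume : Measure (EuclideanSpace ℝ (Fin n))).prod (volume.restrict (ball c t))).restrict (ball c t ×ˢ univ) := by
    rw [← Measure.prod_restrict, Measure.restrict_univ]
  rw [h2]
  refine (h.integrableOn (s := ball c t ×ˢ univ)).congr_fun ?_ (measurableSet_ball.prod MeasurableSet.univ)
  rintro ⟨x, y⟩ ⟨hx, -⟩
  simp only at hx
  simp only [indicator_of_mem hx, one_mul]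

/-- The energy of the ball. -/
noncomputable def enrg {n : ℕ} (c : EuclideanSpace ℝ (Fin n)) (t : ℝ) : ℝ :=
  ∫ p : EuclideanSpace ℝ (Fin n) × EuclideanSpace ℝ (Fin n), ‖p.1 - p.2‖ ^ 2 * (‖p.1 - p.2‖ ^ n)⁻¹
    ∂((volume.restrict (ball c t)).prod (volume.restrict (ball c t)))

lemma Jk_DD {n : ℕ} (hn : 2 ≤ n) (c b0 : EuclideanSpace ℝ (Fin n)) (l t : ℝ)
    (hD : ball c t ⊆ closedBall 0 1) :
    2 * ∫ x in ball c t, ∫ y in ball c t, Jk c b0 l x y = -l * enrg c t := by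
  have h := Jk_DD_int hn c b0 l t hD
  rw [integral_integral h, two_mul]
  nth_rewrite 2 [← integral_prod_swap]
  have h' : Integrable (fun p : EuclideanSpace ℝ (Fin n) × EuclideanSpace ℝ (Fin n) =>
      Jk c b0 l p.swap.1 p.swap.2)
      ((volume.restrict (ball c t)).prod (volume.restrict (ball c t))) := h.swap
  rw [← integral_add h h', enrg, ← integral_const_mul]
  refine integral_congr_ae (Eventually.of_forall fun p => ?_)
  exact Jk_symm c b0 l p.1 p.2

lemma enrg_pos {n : ℕ} (hn : 2 ≤ n) (c : EuclideanSpace ℝ (Fin n)) (t : ℝ) (ht : 0 < t)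
    (hD : ball c t ⊆ closedBall 0 1) : 0 < enrg c t := by
  have h := Jk_DD_int hn c 0 (-1) t hD
  have hi : Integrable (fun p : EuclideanSpace ℝ (Fin n) × EuclideanSpace ℝ (Fin n) =>
      ‖p.1 - p.2‖ ^ 2 * (‖p.1 - p.2‖ ^ n)⁻¹)
      ((volume.restrict (ball c t)).prod (volume.restrict (ball c t))) := by
    refine (h.add h.swap).congr (Eventually.of_forall fun p => ?_)
    have := Jk_symm c 0 (-1) p.1 p.2
    simp only [neg_neg, one_mul] at this
    exact this
  unfold enrg
  rw [integral_pos_iff_support_of_nonneg (fun p => by positivity) hi]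
  have hne : Nonempty (Fin n) := ⟨⟨0, by omega⟩⟩
  have : Nontrivial (EuclideanSpace ℝ (Fin n)) := inferInstance
  obtain ⟨v, hv⟩ := exists_norm_eq (EuclideanSpace ℝ (Fin n)) (c := t/2) (by positivity)
  rw [Measure.prod_restrict, Measure.restrict_apply']
  swap
  · exact measurableSet_ball.prod measurableSet_ball
  refine lt_of_lt_of_le (IsOpen.measure_pos _ (U := {p | p.1 ≠ p.2} ∩ (ball c t ×ˢ ball c t)) ?_ ?_)
    (measure_mono (inter_subset_inter_left _ ?_))
  · refine IsOpen.inter ?_ (isOpen_ball.prod isOpen_ball)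
    exact isOpen_ne_fun continuous_fst continuous_snd
  · refine ⟨(c + v, c), ?_, ?_, ?_⟩
    · have : v ≠ 0 := by rw [← norm_pos_iff, hv]; positivity
      simpa using this
    · simp [hv]; linarith
    · simpa using ht
  · rintro p hp
    have : 0 < ‖p.1 - p.2‖ := norm_pos_iff.2 (sub_ne_zero.2 hp)
    simp only [Function.mem_support]
    positivity

lemma odd_int {n : ℕ} (c b : EuclideanSpace ℝ (Fin n)) (t : ℝ) :
    ∫ x in ball c t, hker 0 b (x - c) = 0 := by
  rw [← integral_indicator measurableSet_ball]
  set q := (ball c t).indicator (fun x => hker 0 b (x - c)) with hq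
  have h1 := integral_sub_left_eq_self q volume (c + c)
  have h2 : ∀ x, q (c + c - x) = - q x := by
    intro x
    have e1 : (c + c - x) - c = -(x - c) := by abel
    by_cases hx : x ∈ ball c t
    · have hx' : c + c - x ∈ ball c t := by
        rw [mem_ball, dist_eq_norm] at hx ⊢; rw [e1, norm_neg]; exact hx
      rw [hq, indicator_of_mem hx, indicator_of_mem hx', e1]
      simp only [hker, norm_neg, inner_neg_right]; ring
    · have hx' : c + c - x ∉ ball c t := by
        rw [mem_ball, dist_eq_norm] at hx ⊢; rw [e1, norm_neg]; exact hx
      rw [hq, indicator_of_notMem hx, indicator_of_notMem hx', neg_zero]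
  simp only [h2, integral_neg] at h1
  linarith

lemma IsDens.pot_mean {n : ℕ} (hn : 2 ≤ n) {f σ : EuclideanSpace ℝ (Fin n) → ℝ}
    (hσ : IsDens f σ) (c b0 : EuclideanSpace ℝ (Fin n)) (l t : ℝ) (ht : 0 < t)
    (hD : ball c t ⊆ closedBall 0 1) (hneg : ∀ x ∈ ball c t, f x < 0)
    (h0 : (0 : EuclideanSpace ℝ (Fin n)) ∉ ball c t) :
    ∫ y in ball c t, pot σ 0 (b0 + l • (y - c)) y =
      volume.real (ball c t) * pot σ 0 b0 c - l * enrg c t := by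
  set D := ball c t with hDdef
  set β := volume.real (ball (0 : EuclideanSpace ℝ (Fin n)) 1) with hβ
  have hpi := Jk_prod_int hn c b0 l t hD hσ.meas hσ.supp_abs hσ.supp_norm
  have e0 : ∀ y, pot σ 0 (b0 + l • (y - c)) y = (∫ x, σ x * Jk c b0 l x y) - β * Jk c b0 l 0 y := by
    intro y; simp only [pot, Jk, zero_sub, hβ]
  have i1 : IntegrableOn (fun y => ∫ x, σ x * Jk c b0 l x y) D := hpi.integral_prod_right
  have i2 := (Jk_integrableOn hn c b0 l t 0).const_mul β
  simp only [e0]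
  rw [integral_sub i1 i2, integral_const_mul, Jk_mean hn c b0 l t ht 0 h0]
  have e1 : ∫ y in D, ∫ x, σ x * Jk c b0 l x y = ∫ x, ∫ y in D, σ x * Jk c b0 l x y :=
    (integral_integral_swap (f := fun x y => σ x * Jk c b0 l x y) hpi).symm
  have i3 : Integrable (fun x => ∫ y in D, σ x * Jk c b0 l x y) := hpi.integral_prod_left
  set W := fun x => ∫ y in D, Jk c b0 l x y with hW
  have i4 : IntegrableOn W D := (Jk_DD_int hn c b0 l t hD).integral_prod_left
  have i5 : IntegrableOn (fun x => hker 0 b0 (x - c)) D := by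
    refine (hker_integrableOn_sub hn 0 b0 c (‖c‖ + t)).mono_set ?_
    refine ball_subset_ball' ?_
    simp [add_comm]
  set V := volume.real D with hV
  have e2 : ∀ x, ∫ y in D, σ x * Jk c b0 l x y =
      V * (σ x * hker 0 b0 (x - c)) + D.indicator (fun x => 2 * (W x - V * hker 0 b0 (x - c))) x := by
    intro x
    rw [integral_const_mul]
    by_cases hx : x ∈ D
    · rw [indicator_of_mem hx, hσ.eq_two x (hD hx) (hneg x hx)]
      simp only [hW]; ring
    · rw [indicator_of_notMem hx, Jk_mean hn c b0 l t ht x hx]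
      ring
  rw [e1]
  simp only [e2]
  have i6 : Integrable (D.indicator (fun x => 2 * (W x - V * hker 0 b0 (x - c)))) :=
    (integrable_indicator_iff measurableSet_ball).2 ((i4.sub (i5.const_mul V)).const_mul 2)
  rw [integral_add ((hσ.int_hker hn 0 b0 c).const_mul V) i6,
    integral_const_mul, integral_indicator measurableSet_ball, integral_const_mul,
    integral_sub i4 (i5.const_mul V), integral_const_mul, odd_int]
  have e3 := Jk_DD hn c b0 l t hD
  have e4 : pot σ 0 b0 c = (∫ x, σ x * hker 0 b0 (x - c)) - β * hker 0 b0 (0 - c) := by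
    simp only [pot, zero_sub, hβ]
  rw [e4]
  simp only [hW]
  linear_combination e3

lemma IsDens.case_zero {n : ℕ} (hn : 2 ≤ n) {f σ : EuclideanSpace ℝ (Fin n) → ℝ}
    (hσ : IsDens f σ) (hf : ContinuousOn f (closedBall 0 1)) (hsub : SubMean f (ball 0 1))
    (hz0 : ∀ x ∈ ball (0 : EuclideanSpace ℝ (Fin n)) (rhon n), f x = 0)
    (z : EuclideanSpace ℝ (Fin n)) (hz2 : ‖z‖ < 1) (hfz : f z < 0) : False := by
  set N := ball (0 : EuclideanSpace ℝ (Fin n)) 1 ∩ f ⁻¹' Iio 0 with hN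
  have hNo : IsOpen N := (hf.mono ball_subset_closedBall).isOpen_inter_preimage isOpen_ball isOpen_Iio
  have hNb : Bornology.IsBounded N := isBounded_ball.subset inter_subset_left
  have hzN : z ∈ N := ⟨by simpa using hz2, hfz⟩
  have hdis : closure N ⊆ (ball 0 (rhon n))ᶜ := by
    refine closure_minimal ?_ isOpen_ball.isClosed_compl
    rintro x ⟨-, hx⟩ hx2
    have := hz0 x hx2
    simp only [mem_preimage, mem_Iio] at hx
    linarith
  have hcl0 : ∀ x ∈ closure N, x ≠ 0 := by
    rintro x hx rfl
    exact hdis hx (by simpa using rhon_pos n)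
  have hNcl : closure N ⊆ closedBall 0 1 :=
    closure_minimal (inter_subset_left.trans ball_subset_closedBall) isClosed_closedBall
  have hcont : ∀ b, ContinuousOn (pot σ 0 b) (closure N) := fun b x hx =>
    (hσ.pot_cont hn 0 b x (hcl0 x hx)).continuousWithinAt
  -- vanishing on the frontier
  have hlim : ∀ b x, x ∈ closure N → x ∈ closure {y | pot σ 0 b y = 0} → pot σ 0 b x = 0 := by
    intro b x hx hx2
    have hc := hσ.pot_cont hn 0 b x (hcl0 x hx)
    have h1 := mem_closure_image hc hx2
    have h2 : closure (pot σ 0 b '' {y | pot σ 0 b y = 0}) ⊆ {0} := by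
      refine closure_minimal ?_ isClosed_singleton
      rintro _ ⟨y, hy, rfl⟩
      exact hy
    exact h2 h1
  have hfr : ∀ b, ∀ x ∈ frontier N, pot σ 0 b x = 0 := by
    intro b x hx
    have hxc : x ∈ closure N := frontier_subset_closure hx
    refine hlim b x hxc ?_
    have hx1 : ‖x‖ ≤ 1 := by simpa using hNcl hxc
    rcases hx1.eq_or_lt with h1 | h1
    · have h3 : {y : EuclideanSpace ℝ (Fin n) | 1 < ‖y‖} ⊆ {y | pot σ 0 b y = 0} :=
        fun y hy => hσ.pot_ext 0 b y hy
      refine closure_mono h3 ?_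
      have h4 : Tendsto (fun s : ℝ => s • x) (𝓝[>] 1) (𝓝 x) := by
        have : Tendsto (fun s : ℝ => s • x) (𝓝 1) (𝓝 ((1:ℝ) • x)) :=
          (continuous_id.smul continuous_const).tendsto 1
        rw [one_smul] at this
        exact this.mono_left nhdsWithin_le_nhds
      refine mem_closure_of_tendsto h4 ?_
      filter_upwards [self_mem_nhdsWithin] with s hs
      have hs' : (1:ℝ) < s := hs
      simp only [norm_smul, h1, mul_one, Real.norm_eq_abs]
      exact hs'.trans_le (le_abs_self s)
    · have hxb : x ∈ ball (0 : EuclideanSpace ℝ (Fin n)) 1 := by simpa using h1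
      have h3 : {y : EuclideanSpace ℝ (Fin n) | ‖y‖ ≤ 1 ∧ 0 < f y} ⊆ {y | pot σ 0 b y = 0} :=
        fun y hy => (hσ.pot_pos hn hf hsub y hy.1 hy.2).2 0 b
      refine closure_mono h3 ?_
      by_contra hcon
      have h5 : ∀ᶠ y in 𝓝 x, y ∈ ball (0 : EuclideanSpace ℝ (Fin n)) 1 ∧
          y ∉ {y : EuclideanSpace ℝ (Fin n) | ‖y‖ ≤ 1 ∧ 0 < f y} := by
        have := isClosed_closure.isOpen_compl.mem_nhds hcon
        filter_upwards [isOpen_ball.mem_nhds hxb, this] with y hy hy2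
        exact ⟨hy, fun h => hy2 (subset_closure h)⟩
      obtain ⟨r, hr, h6⟩ := Metric.nhds_basis_closedBall.mem_iff.1 h5
      have h7 : ∀ y ∈ closedBall x r, f y ≤ 0 := by
        intro y hy
        by_contra! hlt
        have hyb : ‖y‖ < 1 := by simpa using (h6 hy).1
        exact (h6 hy).2 ⟨hyb.le, hlt⟩
      have h8 : 0 ≤ f x := by
        by_contra! hlt
        rw [hNo.frontier_eq] at hx
        exact hx.2 ⟨hxb, hlt⟩
      have h9 := hsub.eq_of_max hr (fun y hy => (h6 hy).1)
        (hf.mono fun y hy => ball_subset_closedBall (h6 hy).1) (fun y hy => (h7 y hy).trans h8)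
      obtain ⟨w, hw, hwN⟩ := mem_closure_iff_nhds.1 hxc _ (closedBall_mem_nhds x hr)
      have e1 := h9 w hw
      have e2 : f w < 0 := hwN.2
      linarith
  have hmv : ∀ b0 l c t, 0 < t → closedBall c t ⊆ N →
      ∫ y in ball c t, pot σ 0 (b0 + l • (y - c)) y =
      volume.real (ball c t) * pot σ 0 b0 c - l * enrg c t := by
    intro b0 l c t ht hcN
    refine hσ.pot_mean hn c b0 l t ht ?_ ?_ ?_
    · exact fun x hx => ball_subset_closedBall (hcN (ball_subset_closedBall hx)).1
    · exact fun x hx => (hcN (ball_subset_closedBall hx)).2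
    · exact fun h => hcl0 0 (subset_closure (hcN (ball_subset_closedBall h))) rfl
  have hmv0 : ∀ b0 c t, 0 < t → closedBall c t ⊆ N →
      ∫ y in ball c t, pot σ 0 b0 y = volume.real (ball c t) * pot σ 0 b0 c := by
    intro b0 c t ht hcN
    simpa using hmv b0 0 c t ht hcN
  have hsm : ∀ b, SubMean (pot σ 0 b) N := by
    intro b x r hr hrN
    rw [setInt_closedBall hn, vol_closedBall hn, hmv0 b x r hr hrN]
  have hsm' : ∀ b, SubMean (fun y => -pot σ 0 b y) N := by
    intro b x r hr hrN
    rw [setInt_closedBall hn, vol_closedBall hn, integral_neg, hmv0 b x r hr hrN]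
    linarith
  have hzero : ∀ b, ∀ x ∈ N, pot σ 0 b x = 0 := by
    intro b x hx
    have h1 := weak_max hn hNo hNb (hcont b) (hsm b) (fun x hx => (hfr b x hx).le) x hx
    have h2 := weak_max hn hNo hNb (hcont b).neg (hsm' b) (fun x hx => by
      have := hfr b x hx; simp [this]) x hx
    replace h2 : -pot σ 0 b x ≤ 0 := h2
    linarith
  obtain ⟨r, hr, hrN⟩ := Metric.nhds_basis_closedBall.mem_iff.1 (hNo.mem_nhds hzN)
  have h1 := hmv 0 1 z r hr hrN
  rw [hzero 0 z hzN, setIntegral_congr_fun (g := fun _ => (0:ℝ)) measurableSet_ball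
    (fun y hy => hzero _ y (hrN (ball_subset_closedBall hy)))] at h1
  have h2 := enrg_pos hn z r hr
    (fun x hx => ball_subset_closedBall (hrN (ball_subset_closedBall hx)).1)
  simp only [integral_zero, mul_zero] at h1
  linarith

lemma split_ball {n : ℕ} (hn : 2 ≤ n) {g : EuclideanSpace ℝ (Fin n) → ℝ}
    (hg : IntegrableOn g (ball 0 1)) :
    ∫ x in ball 0 1, g x = (∫ x in ball 0 1 \ ball 0 (rhon n), g x) + ∫ x in ball 0 (rhon n), g x := by
  have h := integral_inter_add_sdiff (s := ball (0 : EuclideanSpace ℝ (Fin n)) 1)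
    (t := ball (0 : EuclideanSpace ℝ (Fin n)) (rhon n)) measurableSet_ball hg
  rw [inter_eq_right.2 (ball_subset_ball (rhon_lt hn).le)] at h
  linarith

lemma harm_split {n : ℕ} (hn : 2 ≤ n) {u : EuclideanSpace ℝ (Fin n) → ℝ}
    (hu : HarmonicOn u (ball 0 1)) (hg : IntegrableOn u (ball 0 1)) :
    (∫ x in ball 0 1 \ ball 0 (rhon n), u x) = ∫ x in ball 0 (rhon n), u x := by
  have hs : ball (0 : EuclideanSpace ℝ (Fin n)) (rhon n) ⊆ ball 0 1 := ball_subset_ball (rhon_lt hn).le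
  have h1 := mvp 0 1 one_pos hu hg
  have h2 := mvp 0 (rhon n) (rhon_pos n) ⟨hu.1.mono hs, fun x hx => hu.2 x (hs hx)⟩ (hg.mono_set hs)
  rw [vol_ball hn _ _ (rhon_pos n).le, rhon_pow hn] at h2
  have h3 := split_ball hn hg
  linarith

lemma main_bwd {n : ℕ} (hn : 2 ≤ n) (ω h : EuclideanSpace ℝ (Fin n) → ℝ)
    (hωc : ContinuousOn ω (closedBall (0 : EuclideanSpace ℝ (Fin n)) 1))
    (hωs : SubharmonicOn ω (ball (0 : EuclideanSpace ℝ (Fin n)) 1))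
    (hhc : ContinuousOn h (closedBall (0 : EuclideanSpace ℝ (Fin n)) 1))
    (hhh : HarmonicOn h (ball (0 : EuclideanSpace ℝ (Fin n)) 1))
    (h1 : ∀ x ∈ sphere (0 : EuclideanSpace ℝ (Fin n)) (rhon n), h x = ω x)
    (h2 : ∀ x ∈ closedBall (0 : EuclideanSpace ℝ (Fin n)) 1 \
          ball (0 : EuclideanSpace ℝ (Fin n)) (rhon n), h x ≤ ω x)
    (u : EuclideanSpace ℝ (Fin n) → ℝ) (hu : HarmonicOn u (ball 0 1))
    (hui : IntegrableOn u (ball 0 1)) :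
    (∫ x in ball (0 : EuclideanSpace ℝ (Fin n)) 1, |ω x - h x|)
        ≤ ∫ x in ball (0 : EuclideanSpace ℝ (Fin n)) 1, |ω x - u x| := by
  have hs : ball (0 : EuclideanSpace ℝ (Fin n)) (rhon n) ⊆ ball 0 1 := ball_subset_ball (rhon_lt hn).le
  have hd : ball (0 : EuclideanSpace ℝ (Fin n)) 1 \ ball 0 (rhon n) ⊆ ball 0 1 := sdiff_subset
  have hmd : MeasurableSet (ball (0 : EuclideanSpace ℝ (Fin n)) 1 \ ball 0 (rhon n)) :=
    measurableSet_ball.diff measurableSet_ball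
  have hsub := subMean_diff hn ω h hωc hωs hhc hhh
  have hωi : IntegrableOn ω (ball 0 1) :=
    (hωc.integrableOn_compact (isCompact_closedBall _ _)).mono_set ball_subset_closedBall
  have hhi : IntegrableOn h (ball 0 1) :=
    (hhc.integrableOn_compact (isCompact_closedBall _ _)).mono_set ball_subset_closedBall
  have hin : ∀ x ∈ ball (0 : EuclideanSpace ℝ (Fin n)) (rhon n), ω x - h x ≤ 0 := by
    refine weak_max hn isOpen_ball isBounded_ball ?_ (hsub.mono hs) ?_
    · refine (hωc.sub hhc).mono (closure_ball_subset_closedBall.trans ?_)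
      exact closedBall_subset_closedBall (rhon_lt hn).le
    · intro x hx
      rw [h1 x (frontier_ball_subset_sphere hx)]; simp
  have hdi : IntegrableOn (fun x => ω x - u x) (ball 0 1) := hωi.sub hui
  have hfi : IntegrableOn (fun x => ω x - h x) (ball 0 1) := hωi.sub hhi
  rw [split_ball hn hfi.abs, split_ball hn hdi.abs]
  have e1 : ∫ x in ball 0 1 \ ball 0 (rhon n), |ω x - h x| = 
      (∫ x in ball 0 1 \ ball 0 (rhon n), ω x) - ∫ x in ball 0 1 \ ball 0 (rhon n), h x := by
    rw [← integral_sub (hωi.mono_set hd) (hhi.mono_set hd)]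
    refine setIntegral_congr_fun hmd fun x hx => abs_of_nonneg ?_
    have := h2 x ⟨ball_subset_closedBall hx.1, hx.2⟩
    linarith
  have e2 : ∫ x in ball 0 (rhon n), |ω x - h x| = 
      (∫ x in ball 0 (rhon n), h x) - ∫ x in ball 0 (rhon n), ω x := by
    rw [← integral_sub (hhi.mono_set hs) (hωi.mono_set hs)]
    refine setIntegral_congr_fun measurableSet_ball fun x hx => ?_
    rw [abs_of_nonpos (hin x hx)]; ring
  have e3 : (∫ x in ball 0 1 \ ball 0 (rhon n), ω x) - ∫ x in ball 0 1 \ ball 0 (rhon n), u x ≤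
      ∫ x in ball 0 1 \ ball 0 (rhon n), |ω x - u x| := by
    rw [← integral_sub (hωi.mono_set hd) (hui.mono_set hd)]
    exact integral_mono (hdi.mono_set hd) (hdi.mono_set hd).abs fun x => le_abs_self _
  have e4 : (∫ x in ball 0 (rhon n), u x) - ∫ x in ball 0 (rhon n), ω x ≤
      ∫ x in ball 0 (rhon n), |ω x - u x| := by
    rw [← integral_sub (hui.mono_set hs) (hωi.mono_set hs)]
    refine integral_mono ((hui.sub hωi).mono_set hs) (hdi.mono_set hs).abs fun x => ?_
    simp only
    rw [abs_sub_comm]; exact le_abs_self _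
  have e5 := harm_split hn hu hui
  have e6 := harm_split hn hhh hhi
  linarith

lemma main_fwd {n : ℕ} (hn : 2 ≤ n) (ω h : EuclideanSpace ℝ (Fin n) → ℝ)
    (hωc : ContinuousOn ω (closedBall (0 : EuclideanSpace ℝ (Fin n)) 1))
    (hωs : SubharmonicOn ω (ball (0 : EuclideanSpace ℝ (Fin n)) 1))
    (hhc : ContinuousOn h (closedBall (0 : EuclideanSpace ℝ (Fin n)) 1))
    (hhh : HarmonicOn h (ball (0 : EuclideanSpace ℝ (Fin n)) 1))
    (hb : ∀ u : EuclideanSpace ℝ (Fin n) → ℝ,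
      HarmonicOn u (ball (0 : EuclideanSpace ℝ (Fin n)) 1) →
      IntegrableOn u (ball (0 : EuclideanSpace ℝ (Fin n)) 1) →
      (∫ x in ball (0 : EuclideanSpace ℝ (Fin n)) 1, |ω x - h x|)
        ≤ ∫ x in ball (0 : EuclideanSpace ℝ (Fin n)) 1, |ω x - u x|) :
    ((∀ x ∈ sphere (0 : EuclideanSpace ℝ (Fin n)) (rhon n), h x = ω x) ∧
       (∀ x ∈ closedBall (0 : EuclideanSpace ℝ (Fin n)) 1 \
          ball (0 : EuclideanSpace ℝ (Fin n)) (rhon n), h x ≤ ω x)) := by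
  have hs : ball (0 : EuclideanSpace ℝ (Fin n)) (rhon n) ⊆ ball 0 1 := ball_subset_ball (rhon_lt hn).le
  have hsub := subMean_diff hn ω h hωc hωs hhc hhh
  have hhi : IntegrableOn h (ball 0 1) :=
    (hhc.integrableOn_compact (isCompact_closedBall _ _)).mono_set ball_subset_closedBall
  set f := fun x => ω x - h x with hf
  have hfc : ContinuousOn f (closedBall 0 1) := hωc.sub hhc
  obtain ⟨σ, hσ⟩ := exists_dens hn f hfc (by
    intro u hu hui
    have := hb (fun y => h y + 1 * u y) (hhh.lin isOpen_ball 1 hu) (hhi.add (hui.const_mul 1))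
    simpa [hf, sub_sub] using this)
  have hle : ∀ x ∈ ball (0 : EuclideanSpace ℝ (Fin n)) (rhon n), f x ≤ 0 := by
    intro x hx
    by_contra! hlt
    have hx' : ‖x‖ < rhon n := by simpa using hx
    have := hσ.pos_norm hn hfc hsub x (hx'.le.trans (rhon_lt hn).le) hlt
    linarith
  have hann : ∀ z : EuclideanSpace ℝ (Fin n), rhon n < ‖z‖ → ‖z‖ < 1 → f z < 0 → False := by
    intro z hz1 hz2 hfz
    by_cases hall : ∀ x ∈ ball (0 : EuclideanSpace ℝ (Fin n)) (rhon n), f x < 0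
    · exact hσ.case_neg hn hfc hall z hz1 hz2 hfz
    · push Not at hall
      obtain ⟨x0, hx0, h0⟩ := hall
      have := strong_max isOpen_ball (convex_ball _ _).isPreconnected
        (hfc.mono (hs.trans ball_subset_closedBall)) (hsub.mono hs) hle hx0
        (le_antisymm (hle x0 hx0) h0)
      exact hσ.case_zero hn hfc hsub this z hz2 hfz
  have hge : ∀ x ∈ closedBall (0 : EuclideanSpace ℝ (Fin n)) 1 \
          ball (0 : EuclideanSpace ℝ (Fin n)) (rhon n), 0 ≤ f x := by
    rintro x ⟨hx1, hx2⟩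
    by_contra! hlt
    obtain ⟨z, hz1, hz2, hz3⟩ := annulus_pt hn hfc x (by simpa using hx1) (by simpa using hx2) hlt
    exact hann z hz1 hz2 hz3
  have hcl : closedBall (0 : EuclideanSpace ℝ (Fin n)) (rhon n) ⊆ closedBall 0 1 :=
    closedBall_subset_closedBall (rhon_lt hn).le
  refine ⟨fun x hx => ?_, fun x hx => by have := hge x hx; simp only [hf] at this; linarith⟩
  have hxc : x ∈ closedBall (0 : EuclideanSpace ℝ (Fin n)) (rhon n) := sphere_subset_closedBall hx
  have h1 : f x ≤ 0 := by
    have hc2 : ContinuousOn f (closure (ball 0 (rhon n))) := by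
      rw [closure_ball _ (rhon_pos n).ne']; exact hfc.mono hcl
    have hxc2 : x ∈ closure (ball (0 : EuclideanSpace ℝ (Fin n)) (rhon n)) := by
      rw [closure_ball _ (rhon_pos n).ne']; exact hxc
    exact le_on_closure (f := f) (g := fun _ => 0) hle hc2 continuousOn_const hxc2
  have h2 := hge x ⟨hcl hxc, by simp at hx; simp [hx]⟩
  simp only [hf] at h1 h2
  linarith

end helpers

/-- Corollary 6.4 (AGHR): for `ω` continuous on the closed unit ball and subharmonic
on `B`, and `h` continuous on the closed unit ball and harmonic on `B`, `h` is a best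
`L¹`-harmonic approximant to `ω` iff `h = ω` on `∂B₀` and `h ≤ ω` on `closure B ∖ B₀`. -/
theorem stmt_18 (n : ℕ) (hn : 2 ≤ n) (ω h : EuclideanSpace ℝ (Fin n) → ℝ)
    (hωc : ContinuousOn ω (closedBall (0 : EuclideanSpace ℝ (Fin n)) 1))
    (hωs : SubharmonicOn ω (ball (0 : EuclideanSpace ℝ (Fin n)) 1))
    (hhc : ContinuousOn h (closedBall (0 : EuclideanSpace ℝ (Fin n)) 1))
    (hhh : HarmonicOn h (ball (0 : EuclideanSpace ℝ (Fin n)) 1)) :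
    (∀ u : EuclideanSpace ℝ (Fin n) → ℝ,
      HarmonicOn u (ball (0 : EuclideanSpace ℝ (Fin n)) 1) →
      IntegrableOn u (ball (0 : EuclideanSpace ℝ (Fin n)) 1) →
      (∫ x in ball (0 : EuclideanSpace ℝ (Fin n)) 1, |ω x - h x|)
        ≤ ∫ x in ball (0 : EuclideanSpace ℝ (Fin n)) 1, |ω x - u x|)
    ↔ ((∀ x ∈ sphere (0 : EuclideanSpace ℝ (Fin n)) (rhon n), h x = ω x) ∧
       (∀ x ∈ closedBall (0 : EuclideanSpace ℝ (Fin n)) 1 \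
          ball (0 : EuclideanSpace ℝ (Fin n)) (rhon n), h x ≤ ω x)) := by
  exact ⟨main_fwd hn ω h hωc hωs hhc hhh,
    fun H => main_bwd hn ω h hωc hωs hhc hhh H.1 H.2⟩
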